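/- arXiv:2502.14408 — 4 statements merged into one kernel-verified Lean document; each statement's English description precedes it below -/
import Mathlib

section
/- Let A be an integral domain, P ∈ A[Y] monic of degree n ≥ 1, and p a positive divisor of n whose image in A is invertible. Let P₁(Z) := P(Z^{−1}), regarded as an element of the ring A((Z)) of formal Laurent series over A. Then there is a unique P₂ ∈ A((Z)) with P₂^p = P₁ and such that P₂ − Z^{−n/p} has all its terms of Z-exponent strictly greater than −n/p. Let M(P₂) ∈ A[Z^{−1}] be the sum of the terms of P₂ whose Z-exponent is ≤ 0, and let Q(Y) := M(P₂)(Y^{−1}) ∈ A[Y]. Then Q = √[p]{P}. -/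
/-- `Q` is the `p`-th approximate root of `P`: `Q` is monic of degree `deg P / p` and
`deg (P - Q ^ p) < deg P - deg P / p`. -/
def IsApproxRoot {A : Type*} [CommRing A] (P Q : Polynomial A) (p : ℕ) : Prop :=
  Q.Monic ∧ Q.natDegree = P.natDegree / p ∧
    (P - Q ^ p).degree < ((P.natDegree - P.natDegree / p : ℕ) : WithBot ℕ)

theorem PowerSeries.exists_pow_eq_of_constantCoeff_eq_one {A : Type*} [CommRing A] {p : ℕ}
    (hp : 0 < p) (hinv : IsUnit (p : A)) (g : PowerSeries A)
    (hg : PowerSeries.constantCoeff g = 1) :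
    ∃ u : PowerSeries A, u ^ p = g ∧ PowerSeries.constantCoeff u = 1 := by
  obtain ⟨u, hu, hu'⟩ := HenselianRing.is_henselian
    (I := Ideal.span {(PowerSeries.X : PowerSeries A)})
    (Polynomial.X ^ p - Polynomial.C g)
    (Polynomial.monic_X_pow_sub_C g hp.ne') 1
    (by simp [Ideal.mem_span_singleton, PowerSeries.X_dvd_iff, hg])
    (by simpa [Polynomial.derivative_X_pow] using (hinv.map (PowerSeries.C (R := A))).map
          (Ideal.Quotient.mk (Ideal.span {(PowerSeries.X : PowerSeries A)})))
  refine ⟨u, by simpa [sub_eq_zero] using hu, ?_⟩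
  simpa [Ideal.mem_span_singleton, PowerSeries.X_dvd_iff, sub_eq_zero] using hu'

theorem PowerSeries.eq_of_pow_eq_of_constantCoeff_eq_one {A : Type*} [CommRing A] [IsDomain A]
    {p : ℕ} (hp : (p : A) ≠ 0) {u v : PowerSeries A} (huv : u ^ p = v ^ p)
    (hu : PowerSeries.constantCoeff u = 1) (hv : PowerSeries.constantCoeff v = 1) : u = v := by
  have h := (Commute.all u v).geom_sum₂_mul p
  rw [huv, sub_self, mul_eq_zero, sub_eq_zero] at h
  refine h.resolve_left fun h0 => hp ?_
  simpa [hu, hv] using congrArg (PowerSeries.constantCoeff (R := A)) h0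

namespace LaurentSeries

variable {A : Type*} [CommRing A]

theorem aeval_single_neg_one_coeff (P : Polynomial A) (k : ℤ) :
    (Polynomial.aeval (HahnSeries.single (-1 : ℤ) (1 : A)) P : LaurentSeries A).coeff k =
      if k ≤ 0 then P.coeff (-k).toNat else 0 := by
  induction P using Polynomial.induction_on' with
  | add p q hp hq =>
    rw [map_add, HahnSeries.coeff_add, hp, hq]
    split_ifs <;> simp
  | monomial m a =>
    have h : (Polynomial.aeval (HahnSeries.single (-1 : ℤ) (1 : A)) (Polynomial.monomial m a) :
        LaurentSeries A) = HahnSeries.single (-(m : ℤ)) a := by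
      rw [Polynomial.aeval_monomial, HahnSeries.single_pow]
      have hC : algebraMap A (LaurentSeries A) a = HahnSeries.C a :=
        HahnSeries.ofPowerSeries_C a
      rw [hC, HahnSeries.C_apply, HahnSeries.single_mul_single]
      simp
    rw [h, HahnSeries.coeff_single, Polynomial.coeff_monomial]
    grind

theorem exists_eq_single_mul_ofPowerSeries (f : LaurentSeries A) (a : ℤ)
    (hf : ∀ k < a, f.coeff k = 0) :
    ∃ u : PowerSeries A, f = HahnSeries.single a 1 * HahnSeries.ofPowerSeries ℤ A u ∧
      PowerSeries.constantCoeff u = f.coeff a := by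
  refine ⟨PowerSeries.mk fun k => f.coeff (k + a), ?_, by simp⟩
  ext k
  rw [HahnSeries.coeff_single_mul, one_mul, PowerSeries.coeff_coe]
  split_ifs with h
  · exact hf k (by omega)
  · rw [PowerSeries.coeff_mk]
    congr 1
    omega

theorem single_mul_ofPowerSeries_coeff_of_lt (u : PowerSeries A) {a k : ℤ} (hk : k < a) :
    (HahnSeries.single a 1 * HahnSeries.ofPowerSeries ℤ A u).coeff k = 0 := by
  rw [HahnSeries.coeff_single_mul, one_mul, PowerSeries.coeff_coe, if_pos (by omega)]

theorem single_mul_ofPowerSeries_coeff_self (u : PowerSeries A) (a : ℤ) :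
    (HahnSeries.single a 1 * HahnSeries.ofPowerSeries ℤ A u).coeff a =
      PowerSeries.constantCoeff u := by
  rw [HahnSeries.coeff_single_mul, one_mul, PowerSeries.coeff_coe]
  simp

theorem single_mul_left_injective (a : ℤ) :
    Function.Injective fun f : LaurentSeries A => HahnSeries.single a (1 : A) * f := by
  intro f g h
  have := congrArg (HahnSeries.single (-a) (1 : A) * ·) h
  simpa [← mul_assoc, HahnSeries.single_mul_single] using this

theorem le_orderTop_iff {f : LaurentSeries A} {a : ℤ} :
    (a : WithTop ℤ) ≤ f.orderTop ↔ ∀ k < a, f.coeff k = 0 := by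
  simp [HahnSeries.le_orderTop_iff_forall]

theorem le_orderTop_mul {f g : LaurentSeries A} {a b : ℤ} (hf : (a : WithTop ℤ) ≤ f.orderTop)
    (hg : (b : WithTop ℤ) ≤ g.orderTop) : ((a + b : ℤ) : WithTop ℤ) ≤ (f * g).orderTop := by
  rw [WithTop.coe_add]
  exact (add_le_add hf hg).trans HahnSeries.orderTop_add_le_mul

theorem le_orderTop_pow {f : LaurentSeries A} {a : ℤ} (hf : (a : WithTop ℤ) ≤ f.orderTop)
    (i : ℕ) : ((i * a : ℤ) : WithTop ℤ) ≤ (f ^ i).orderTop := by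
  induction i with
  | zero =>
    rw [le_orderTop_iff]
    intro k hk
    rw [pow_zero, HahnSeries.coeff_one, if_neg]
    simp at hk
    exact hk.ne
  | succ i ih =>
    rw [pow_succ]
    convert le_orderTop_mul ih hf using 2
    push_cast
    ring

theorem le_orderTop_sum {ι : Type*} (s : Finset ι) (f : ι → LaurentSeries A) {a : ℤ}
    (hf : ∀ i ∈ s, (a : WithTop ℤ) ≤ (f i).orderTop) :
    (a : WithTop ℤ) ≤ (∑ i ∈ s, f i).orderTop := by
  simp only [le_orderTop_iff] at hf ⊢
  intro k hk
  rw [HahnSeries.coeff_sum]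
  exact Finset.sum_eq_zero fun i hi => hf i hi k hk

theorem le_orderTop_pow_sub_pow {f g : LaurentSeries A} {a b : ℤ}
    (hf : (a : WithTop ℤ) ≤ f.orderTop) (hg : (a : WithTop ℤ) ≤ g.orderTop)
    (hfg : (b : WithTop ℤ) ≤ (f - g).orderTop) (p : ℕ) :
    (((p - 1) * a + b : ℤ) : WithTop ℤ) ≤ (f ^ p - g ^ p).orderTop := by
  rw [← (Commute.all f g).geom_sum₂_mul p]
  refine le_orderTop_mul (le_orderTop_sum _ _ fun i hi => ?_) hfg
  convert le_orderTop_mul (le_orderTop_pow hf i) (le_orderTop_pow hg (p - 1 - i)) using 2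
  have hi := Finset.mem_range.mp hi
  rw [← add_mul]
  congr 1
  omega

/-- `P(Z⁻¹)` is `Z ^ (-deg P)` times a power series with constant term the leading coefficient
of `P`. -/
theorem aeval_single_neg_one_eq (P : Polynomial A) :
    ∃ g : PowerSeries A,
      (Polynomial.aeval (HahnSeries.single (-1 : ℤ) (1 : A)) P : LaurentSeries A) =
        HahnSeries.single (-(P.natDegree : ℤ)) 1 * HahnSeries.ofPowerSeries ℤ A g ∧
      PowerSeries.constantCoeff g = P.leadingCoeff := by
  obtain ⟨g, hg, hg'⟩ := exists_eq_single_mul_ofPowerSeries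
    (Polynomial.aeval (HahnSeries.single (-1 : ℤ) (1 : A)) P) (-(P.natDegree : ℤ)) (by
      intro k hk
      rw [aeval_single_neg_one_coeff, if_pos (by omega)]
      exact Polynomial.coeff_eq_zero_of_natDegree_lt (by omega))
  refine ⟨g, hg, hg'.trans ?_⟩
  rw [aeval_single_neg_one_coeff, if_pos (by omega)]
  simp

theorem sub_single_coeff_eq_zero_iff (f : LaurentSeries A) (a : ℤ) :
    (∀ k ≤ a, (f - HahnSeries.single a (1 : A)).coeff k = 0) ↔
      (∀ k < a, f.coeff k = 0) ∧ f.coeff a = 1 := by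
  simp only [HahnSeries.coeff_sub, sub_eq_zero]
  constructor
  · intro h
    refine ⟨fun k hk => ?_, ?_⟩
    · rw [h k hk.le, HahnSeries.coeff_single_of_ne hk.ne]
    · rw [h a le_rfl, HahnSeries.coeff_single_same]
  · rintro ⟨h, h'⟩ k hk
    rcases hk.lt_or_eq with hk | rfl
    · rw [h k hk, HahnSeries.coeff_single_of_ne hk.ne]
    · rw [h', HahnSeries.coeff_single_same]

end LaurentSeries

open LaurentSeries in
theorem isApproxRoot_of_pow_eq {A : Type*} [CommRing A] [Nontrivial A] {P Q : Polynomial A} {p : ℕ}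
    (hp : 0 < p) (hdvd : p ∣ P.natDegree) {f : LaurentSeries A}
    (hf : f ^ p = Polynomial.aeval (HahnSeries.single (-1 : ℤ) (1 : A)) P)
    (hlt : ∀ k < -((P.natDegree / p : ℕ) : ℤ), f.coeff k = 0)
    (hone : f.coeff (-((P.natDegree / p : ℕ) : ℤ)) = 1)
    (hQ : ∀ j : ℕ, Q.coeff j = f.coeff (-(j : ℤ))) : IsApproxRoot P Q p := by
  obtain ⟨d, hd⟩ := hdvd
  rw [hd, Nat.mul_div_cancel_left d hp] at hlt hone
  unfold IsApproxRoot
  rw [hd, Nat.mul_div_cancel_left d hp]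
  have hle : Q.natDegree ≤ d := Polynomial.natDegree_le_iff_coeff_eq_zero.mpr fun j hj => by
    rw [hQ]
    exact hlt _ (by omega)
  have hQd : Q.coeff d = 1 := by rw [hQ, hone]
  refine ⟨Polynomial.monic_of_natDegree_le_of_coeff_eq_one d hle hQd,
    le_antisymm hle (Polynomial.le_natDegree_of_ne_zero (by simp [hQd])), ?_⟩
  set g : LaurentSeries A := Polynomial.aeval (HahnSeries.single (-1 : ℤ) (1 : A)) Q with hg
  have hgc (k : ℤ) : g.coeff k = if k ≤ 0 then f.coeff k else 0 := by
    rw [hg, aeval_single_neg_one_coeff, hQ]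
    split_ifs with hk
    · congr 1
      omega
    · rfl
  have key := le_orderTop_pow_sub_pow (a := -(d : ℤ)) (b := 1) (f := f) (g := g)
    (le_orderTop_iff.mpr hlt)
    (le_orderTop_iff.mpr fun k hk => by rw [hgc, hlt k hk, ite_self])
    (le_orderTop_iff.mpr fun k hk => by
      rw [HahnSeries.coeff_sub, hgc, if_pos (by omega), sub_self]) p
  rw [hf, hg, ← map_pow, ← map_sub, le_orderTop_iff] at key
  rw [Polynomial.degree_lt_iff_coeff_zero]
  intro j hj
  have hj' : ((p : ℤ) - 1) * d ≤ j := by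
    have : p * d ≤ j + d := by omega
    have : (p : ℤ) * d ≤ j + d := by exact_mod_cast this
    linarith
  have := key (-(j : ℤ)) (by linarith)
  rwa [aeval_single_neg_one_coeff, if_pos (by omega), neg_neg, Int.toNat_natCast] at this

/-- **The approximate root via genuine `p`-th roots of Laurent series.**
Let `P ∈ A[Y]` be monic of degree `n ≥ 1` and `p` a positive divisor of `n` invertible in
`A`.  Set `P₁(Z) := P(Z⁻¹) ∈ A((Z))`.  Then there is a unique `P₂ ∈ A((Z))` with
`P₂ ^ p = P₁` whose difference with `Z^(-n/p)` has all terms of exponent `> -n/p`;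
and if `M(P₂)` denotes the sum of the terms of `P₂` of exponent `≤ 0`, then the
polynomial `Q(Y) := M(P₂)(Y⁻¹)` (i.e. the polynomial whose `j`-th coefficient is the
coefficient of `Z^(-j)` in `P₂`) is the `p`-th approximate root of `P`. -/
theorem stmt_3 {A : Type*} [CommRing A] [IsDomain A] (P : Polynomial A) (n p : ℕ)
    (hP : P.Monic) (hdeg : P.natDegree = n) (hn : 1 ≤ n) (hp : 0 < p) (hdvd : p ∣ n)
    (hinv : IsUnit (p : A)) :
    (∃! P₂ : LaurentSeries A,
        P₂ ^ p = Polynomial.aeval (HahnSeries.single (-1 : ℤ) (1 : A)) P ∧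
          ∀ k : ℤ, k ≤ -((n / p : ℕ) : ℤ) →
            (P₂ - HahnSeries.single (-((n / p : ℕ) : ℤ)) (1 : A)).coeff k = 0) ∧
      ∀ P₂ : LaurentSeries A,
        P₂ ^ p = Polynomial.aeval (HahnSeries.single (-1 : ℤ) (1 : A)) P →
        (∀ k : ℤ, k ≤ -((n / p : ℕ) : ℤ) →
          (P₂ - HahnSeries.single (-((n / p : ℕ) : ℤ)) (1 : A)).coeff k = 0) →
        ∀ Q : Polynomial A, (∀ j : ℕ, Q.coeff j = P₂.coeff (-(j : ℤ))) →
          IsApproxRoot P Q p := by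
  subst hdeg
  simp only [LaurentSeries.sub_single_coeff_eq_zero_iff]
  refine ⟨?_, fun f hf h Q hQ => isApproxRoot_of_pow_eq hp hdvd hf h.1 h.2 hQ⟩
  obtain ⟨g, hg, hg1⟩ := LaurentSeries.aeval_single_neg_one_eq P
  rw [hP.leadingCoeff] at hg1
  have hpow (u : PowerSeries A) :
      (HahnSeries.single (-((P.natDegree / p : ℕ) : ℤ)) (1 : A) *
        HahnSeries.ofPowerSeries ℤ A u) ^ p =
      HahnSeries.single (-(P.natDegree : ℤ)) 1 * HahnSeries.ofPowerSeries ℤ A (u ^ p) := by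
    rw [mul_pow, HahnSeries.single_pow, one_pow, map_pow, nsmul_eq_mul, mul_neg, ← Nat.cast_mul,
      Nat.mul_div_cancel' hdvd]
  obtain ⟨u, hu, hu1⟩ := PowerSeries.exists_pow_eq_of_constantCoeff_eq_one hp hinv g hg1
  refine ⟨_, ⟨by rw [hpow u, hu, hg],
    fun k hk => LaurentSeries.single_mul_ofPowerSeries_coeff_of_lt u hk,
    (LaurentSeries.single_mul_ofPowerSeries_coeff_self u _).trans hu1⟩, ?_⟩
  rintro f ⟨hf, hlt, hone⟩
  obtain ⟨v, rfl, hv1⟩ := LaurentSeries.exists_eq_single_mul_ofPowerSeries f _ hlt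
  rw [hpow, hg] at hf
  have hvg := HahnSeries.ofPowerSeries_injective (LaurentSeries.single_mul_left_injective _ hf)
  rw [PowerSeries.eq_of_pow_eq_of_constantCoeff_eq_one hinv.ne_zero (hvg.trans hu.symm)
    (hv1.trans hone) hu1]
end

section
/- Let A be an integral domain and P, Q ∈ A[Y] monic polynomials with deg Q ≥ 1. Then there exist unique polynomials a₀, a₁, …, a_s ∈ A[Y] with s = ⌊deg P / deg Q⌋ and deg a_i < deg Q for all i, such that P = a₀Q^s + a₁Q^{s−1} + ⋯ + a_s. Moreover: (i) a₀ is monic, and for 0 ≤ i < j ≤ s with a_i ≠ 0 and a_j ≠ 0 one has deg(a_iQ^{s−i}) > deg(a_jQ^{s−j}); (ii) a₀ = 1 if and only if deg Q divides deg P; (iii) if deg Q divides deg P and s is invertible in A, then a₁ = 0 if and only if Q = √[s]{P}. -/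
open Polynomial

namespace Polynomial

variable {A : Type*} [CommRing A]

theorem Monic.degree_mul_pow_lt [Nontrivial A] {Q a : A[X]} (hQ : Q.Monic)
    (ha : a.degree < Q.degree) (n : ℕ) : (a * Q ^ n).degree < (Q ^ (n + 1)).degree := by
  rw [pow_succ', (hQ.pow n).degree_mul, (hQ.pow n).degree_mul]
  exact WithBot.add_lt_add_right (by simpa [degree_eq_bot] using (hQ.pow n).ne_zero) ha

theorem Monic.degree_pow_le_degree_pow [Nontrivial A] {Q : A[X]} (hQ : Q.Monic) {m n : ℕ}
    (h : m ≤ n) : (Q ^ m).degree ≤ (Q ^ n).degree := by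
  rw [degree_eq_natDegree (hQ.pow m).ne_zero, degree_eq_natDegree (hQ.pow n).ne_zero,
    hQ.natDegree_pow, hQ.natDegree_pow]
  exact_mod_cast Nat.mul_le_mul_right _ h

theorem Monic.degree_le_degree_mul [Nontrivial A] {Q a : A[X]} (hQ : Q.Monic) (ha : a ≠ 0) :
    Q.degree ≤ (a * Q).degree := by
  rw [hQ.degree_mul]
  exact le_add_of_nonneg_left (zero_le_degree_iff.2 ha)

theorem Monic.degree_sum_mul_pow_lt [Nontrivial A] {Q : A[X]} (hQ : Q.Monic) {b : ℕ → A[X]}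
    (hb : ∀ i, (b i).degree < Q.degree) (n : ℕ) :
    (∑ i ∈ Finset.range n, b i * Q ^ i).degree < (Q ^ n).degree := by
  refine (degree_sum_le _ _).trans_lt ((Finset.sup_lt_iff ?_).2 fun i hi => ?_)
  · exact bot_lt_iff_ne_bot.2 (by simpa [degree_eq_bot] using (hQ.pow n).ne_zero)
  · exact (hQ.degree_mul_pow_lt (hb i) i).trans_le
      (hQ.degree_pow_le_degree_pow (Finset.mem_range.1 hi))

theorem Monic.exists_eq_sum_mul_pow [Nontrivial A] {Q : A[X]} (hQ : Q.Monic) (n : ℕ) (P : A[X])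
    (hP : P.degree < (Q ^ n).degree) :
    ∃ b : ℕ → A[X], (∀ i, (b i).degree < Q.degree) ∧
      P = ∑ i ∈ Finset.range n, b i * Q ^ i := by
  induction n generalizing P with
  | zero =>
    refine ⟨0, fun i => ?_, ?_⟩
    · simpa using bot_lt_iff_ne_bot.2 (mt degree_eq_bot.1 hQ.ne_zero)
    · simpa [Nat.WithBot.lt_zero_iff] using hP
  | succ n ih =>
    have hdiv : (P /ₘ Q).degree < (Q ^ n).degree := by
      by_cases h : Q.degree ≤ P.degree
      · rw [← degree_add_divByMonic hQ h, pow_succ', (hQ.pow n).degree_mul] at hP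
        exact lt_of_add_lt_add_left hP
      · rw [(divByMonic_eq_zero_iff hQ).2 (not_le.1 h), degree_zero]
        exact bot_lt_iff_ne_bot.2 (mt degree_eq_bot.1 (hQ.pow n).ne_zero)
    obtain ⟨b, hb, hbP⟩ := ih _ hdiv
    refine ⟨fun i => Nat.casesOn i (P %ₘ Q) b, fun i => ?_, ?_⟩
    · cases i with
      | zero => exact degree_modByMonic_lt P hQ
      | succ i => exact hb i
    · rw [Finset.sum_range_succ']
      conv_lhs => rw [← modByMonic_add_div P Q, hbP, Finset.mul_sum]
      rw [add_comm]
      congr 1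
      · exact Finset.sum_congr rfl fun i _ => by ring
      · simp

theorem Monic.eq_of_sum_mul_pow_eq [Nontrivial A] {Q : A[X]} (hQ : Q.Monic) {n : ℕ}
    {b c : ℕ → A[X]} (hb : ∀ i, (b i).degree < Q.degree) (hc : ∀ i, (c i).degree < Q.degree)
    (h : ∑ i ∈ Finset.range n, b i * Q ^ i = ∑ i ∈ Finset.range n, c i * Q ^ i) :
    ∀ i < n, b i = c i := by
  induction n generalizing b c with
  | zero => simp
  | succ n ih =>
    have key (d : ℕ → A[X]) : ∑ i ∈ Finset.range (n + 1), d i * Q ^ i =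
        d 0 + Q * ∑ i ∈ Finset.range n, d (i + 1) * Q ^ i := by
      rw [Finset.sum_range_succ', Finset.mul_sum, add_comm]
      congr 1
      · simp
      · exact Finset.sum_congr rfl fun i _ => by ring
    have hb' := div_modByMonic_unique _ _ hQ ⟨(key b).symm, hb 0⟩
    have hc' := div_modByMonic_unique _ _ hQ ⟨(key c).symm, hc 0⟩
    rw [h] at hb'
    rintro (_ | i) hi
    · exact hb'.2.symm.trans hc'.2
    · exact ih (fun i => hb (i + 1)) (fun i => hc (i + 1)) (hb'.1.symm.trans hc'.1) i (by lia)

theorem sum_range_mul_pow_sub (Q : A[X]) (a : ℕ → A[X]) (s : ℕ) :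
    ∑ i ∈ Finset.range (s + 1), a i * Q ^ (s - i) =
      ∑ i ∈ Finset.range (s + 1), a (s - i) * Q ^ i := by
  rw [← Finset.sum_range_reflect]
  refine Finset.sum_congr rfl fun i hi => ?_
  have := Finset.mem_range.1 hi
  congr 2; lia

end Polynomial

/-- **Existence, uniqueness and properties of the `Q`-adic expansion.**
Let `A` be an integral domain and `P, Q ∈ A[Y]` monic with `deg Q ≥ 1`.  Then, with
`s = ⌊deg P / deg Q⌋`, there exist unique `a₀, …, a_s ∈ A[Y]` with `deg aᵢ < deg Q` such
that `P = a₀ Q^s + a₁ Q^(s-1) + ⋯ + a_s`.  Moreover (i) `a₀` is monic and nonzero terms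
have pairwise strictly decreasing degrees, (ii) `a₀ = 1` iff `deg Q ∣ deg P`, and (iii) if
`deg Q ∣ deg P` and `s` is invertible in `A`, then `a₁ = 0` iff `Q` is the `s`-th
approximate root of `P`. -/
theorem stmt_4 {A : Type*} [CommRing A] [IsDomain A] (P Q : Polynomial A) (s : ℕ)
    (hP : P.Monic) (hQ : Q.Monic) (hQdeg : 1 ≤ Q.natDegree)
    (hs : s = P.natDegree / Q.natDegree) :
    (∃! a : ℕ → Polynomial A, (∀ i, (a i).degree < Q.degree) ∧ (∀ i, s < i → a i = 0) ∧
        P = ∑ i ∈ Finset.range (s + 1), a i * Q ^ (s - i)) ∧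
      ∀ a : ℕ → Polynomial A, (∀ i, (a i).degree < Q.degree) → (∀ i, s < i → a i = 0) →
        P = ∑ i ∈ Finset.range (s + 1), a i * Q ^ (s - i) →
        (a 0).Monic ∧
        (∀ i j, i < j → j ≤ s → a i ≠ 0 → a j ≠ 0 →
          (a j * Q ^ (s - j)).degree < (a i * Q ^ (s - i)).degree) ∧
        (a 0 = 1 ↔ Q.natDegree ∣ P.natDegree) ∧
        (Q.natDegree ∣ P.natDegree → IsUnit (s : A) → (a 1 = 0 ↔ IsApproxRoot P Q s)) := by
  have hdP : P.natDegree < (s + 1) * Q.natDegree := by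
    rw [hs, mul_comm]; exact Nat.lt_mul_div_succ _ hQdeg
  have hsP : s * Q.natDegree ≤ P.natDegree := by
    rw [hs]; exact Nat.div_mul_le_self _ _
  have degree_pow (n : ℕ) : (Q ^ n).degree = ((n * Q.natDegree : ℕ) : WithBot ℕ) := by
    rw [degree_eq_natDegree (hQ.pow n).ne_zero, hQ.natDegree_pow]
  have degree_P : P.degree = (P.natDegree : WithBot ℕ) := degree_eq_natDegree hP.ne_zero
  refine ⟨?_, ?_⟩
  · obtain ⟨b, hb, hbP⟩ := hQ.exists_eq_sum_mul_pow (s + 1) P (by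
      rw [degree_pow, degree_P]; exact_mod_cast hdP)
    refine ⟨fun i => if i ≤ s then b (s - i) else 0, ⟨fun i => ?_, fun i hi => ?_, ?_⟩, ?_⟩
    · beta_reduce
      split_ifs
      · exact hb _
      · simpa using bot_lt_iff_ne_bot.2 (mt degree_eq_bot.1 hQ.ne_zero)
    · simp [hi]
    · rw [sum_range_mul_pow_sub, hbP]
      refine Finset.sum_congr rfl fun i hi => ?_
      have := Finset.mem_range.1 hi
      simp [Nat.sub_sub_self (by lia : i ≤ s)]
    · rintro a ⟨ha, ha0, haP⟩
      rw [sum_range_mul_pow_sub] at haP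
      have h := hQ.eq_of_sum_mul_pow_eq (fun i => ha (s - i)) hb (haP.symm.trans hbP)
      funext i
      split_ifs with hi
      · rw [← h (s - i) (by lia), Nat.sub_sub_self hi]
      · exact ha0 i (by lia)
  intro a ha _ haP
  rw [sum_range_mul_pow_sub, Finset.sum_range_succ, Nat.sub_self] at haP
  have hR := hQ.degree_sum_mul_pow_lt (fun i => ha (s - i)) s
  have hmonic : (a 0).Monic := by
    refine (hQ.pow s).of_mul_monic_right ?_
    rw [eq_sub_iff_add_eq'.2 haP.symm]
    refine hP.sub_of_left (hR.trans_le ?_)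
    rw [degree_pow, degree_P]
    exact_mod_cast hsP
  have hnat : P.natDegree = (a 0).natDegree + s * Q.natDegree := by
    rw [← hQ.natDegree_pow, ← hmonic.natDegree_mul (hQ.pow s), haP]
    exact natDegree_add_eq_right_of_degree_lt
      (hR.trans_le ((hQ.pow s).degree_le_degree_mul hmonic.ne_zero))
  have hlt : (a 0).natDegree < Q.natDegree := natDegree_lt_natDegree hmonic.ne_zero (ha 0)
  have hone : a 0 = 1 ↔ Q.natDegree ∣ P.natDegree := by
    rw [← hmonic.natDegree_eq_zero, hnat, Nat.dvd_add_left (Dvd.intro_left _ rfl)]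
    exact ⟨fun h => by simp [h], fun h => Nat.eq_zero_of_dvd_of_lt h hlt⟩
  refine ⟨hmonic, fun i j hij hj hi0 _ => ?_, hone, fun hdvd hunit => ?_⟩
  · exact ((hQ.degree_mul_pow_lt (ha j) (s - j)).trans_le
      (hQ.degree_pow_le_degree_pow (by lia))).trans_le ((hQ.pow _).degree_le_degree_mul hi0)
  · obtain ⟨t, rfl⟩ : ∃ t, s = t + 1 :=
      Nat.exists_eq_add_one_of_ne_zero (by rintro rfl; simp at hunit)
    have hPdeg : P.natDegree = (t + 1) * Q.natDegree := by
      rw [hnat, hone.2 hdvd, natDegree_one, zero_add]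
    have hQdiv : P.natDegree / (t + 1) = Q.natDegree := by
      rw [hPdeg, Nat.mul_div_cancel_left _ t.succ_pos]
    have hbound : P.natDegree - Q.natDegree = t * Q.natDegree := by
      rw [hPdeg, Nat.succ_mul, Nat.add_sub_cancel]
    have hS := hQ.degree_sum_mul_pow_lt (fun i => ha (t + 1 - i)) t
    rw [hone.2 hdvd, one_mul, Finset.sum_range_succ, Nat.add_sub_cancel_left] at haP
    rw [IsApproxRoot, hQdiv, hbound, ← degree_pow, sub_eq_of_eq_add haP]
    constructor
    · intro h
      exact ⟨hQ, rfl, by simpa [h] using hS⟩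
    · rintro ⟨-, -, h⟩
      by_contra h1
      have h2 := (hQ.pow t).degree_le_degree_mul h1
      rw [degree_add_eq_right_of_degree_lt (hS.trans_le h2)] at h
      exact h.not_ge h2
end

section
/- (Epimorphism theorem) Let σ : ℂ[X,Y] → ℂ[T] be a surjective homomorphism of ℂ-algebras from the polynomial ring in two variables to the polynomial ring in one variable, and set P := σ(X), Q := σ(Y). If deg P > 0 and deg Q > 0, then deg P divides deg Q or deg Q divides deg P. -/
open Polynomial

section Expansion

variable {S : Type*} [CommRing S]

theorem exists_expansion_of_monic {G : S[X]} (hG : G.Monic) {N : ℕ} (hN : G.natDegree = N)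
    (a : ℕ) {p : S[X]} (hp : p.degree < ((a * N : ℕ) : WithBot ℕ)) :
    ∃ e : ℕ → S[X], (∀ j, (e j).degree < (N : WithBot ℕ)) ∧
      p = ∑ j ∈ Finset.range a, e j * G ^ j := by
  nontriviality S
  have hGd : G.degree = (N : WithBot ℕ) := by rw [degree_eq_natDegree hG.ne_zero, hN]
  induction a generalizing p with
  | zero =>
    have : p = 0 := by
      rw [← degree_eq_bot]
      simpa [Nat.WithBot.lt_zero_iff] using hp
    exact ⟨fun _ => 0, fun j => by simp, by simp [this]⟩
  | succ a ih =>
    have hq : (p /ₘ G).degree < ((a * N : ℕ) : WithBot ℕ) := by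
      by_cases h : p /ₘ G = 0
      · rw [h, degree_zero]; exact WithBot.bot_lt_coe _
      have hGp : G.degree ≤ p.degree := by
        by_contra hlt
        exact h ((divByMonic_eq_zero_iff hG).2 (not_le.1 hlt))
      have h1 := degree_add_divByMonic hG hGp
      rw [hGd, degree_eq_natDegree h] at h1
      rw [← h1] at hp
      rw [degree_eq_natDegree h]
      norm_cast at hp ⊢
      rw [add_mul, one_mul] at hp
      omega
    obtain ⟨e, he, hsum⟩ := ih hq
    refine ⟨fun j => if j = 0 then p %ₘ G else e (j - 1), fun j => ?_, ?_⟩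
    · dsimp only
      split_ifs
      · rw [← hGd]; exact degree_modByMonic_lt _ hG
      · exact he _
    · rw [Finset.sum_range_succ']
      simp only [Nat.succ_ne_zero, if_false, Nat.add_sub_cancel, if_true, pow_zero, mul_one]
      conv_lhs => rw [← modByMonic_add_div p G, hsum, Finset.mul_sum, add_comm]
      congr 1
      exact Finset.sum_congr rfl fun j _ => by ring

theorem degree_sum_mul_pow_lt [Nontrivial S] {G : S[X]} (hG : G.Monic) {N : ℕ}
    (hN : G.natDegree = N) (a : ℕ) {e : ℕ → S[X]} (he : ∀ j, (e j).degree < (N : WithBot ℕ)) :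
    (∑ j ∈ Finset.range a, e j * G ^ j).degree < ((a * N : ℕ) : WithBot ℕ) := by
  rw [← mem_degreeLT]
  refine Submodule.sum_mem _ fun j hj => ?_
  rw [mem_degreeLT]
  by_cases h : e j = 0
  · rw [h, zero_mul, degree_zero]; exact WithBot.bot_lt_coe _
  have h1 := he j
  rw [(hG.pow j).degree_mul, degree_eq_natDegree h, degree_eq_natDegree (hG.pow j).ne_zero,
    hG.natDegree_pow, hN]
  rw [degree_eq_natDegree h] at h1
  norm_cast at h1 ⊢
  have : (j + 1) * N ≤ a * N := Nat.mul_le_mul_right _ (Finset.mem_range.1 hj)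
  rw [add_mul, one_mul] at this
  omega

/-- The cofactor of `P - P'` in `P ^ (b + 1) - P' ^ (b + 1)`, for monic `P` and `P'` of the same
degree. -/
theorem exists_cofactor_pow_sub_pow {P P' : S[X]} (hP : P.Monic)
    (hP' : P'.Monic) {N : ℕ} (hN : P.natDegree = N) (hN' : P'.natDegree = N) (b : ℕ) :
    ∃ C : S[X], P ^ (b + 1) - P' ^ (b + 1) = (P - P') * C ∧ C.natDegree ≤ b * N ∧
      C.coeff (b * N) = (b + 1 : ℕ) := by
  refine ⟨∑ i ∈ Finset.range (b + 1), P ^ i * P' ^ (b - i), ?_, ?_, ?_⟩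
  · rw [← (Commute.all P P').mul_geom_sum₂]
    simp
  · refine natDegree_sum_le_of_forall_le _ _ fun i hi => ?_
    have hi' := Nat.lt_succ_iff.1 (Finset.mem_range.1 hi)
    rw [(hP.pow i).natDegree_mul (hP'.pow _), hP.natDegree_pow, hP'.natDegree_pow, hN, hN',
      ← add_mul, Nat.add_sub_cancel' hi']
  · rw [finsetSum_coeff, Finset.sum_congr rfl (g := fun _ => (1 : S))]
    · simp
    · intro i hi
      have hi' := Nat.lt_succ_iff.1 (Finset.mem_range.1 hi)
      have hm := (hP.pow i).mul (hP'.pow (b - i))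
      have hd : (P ^ i * P' ^ (b - i)).natDegree = b * N := by
        rw [(hP.pow i).natDegree_mul (hP'.pow _), hP.natDegree_pow, hP'.natDegree_pow, hN, hN',
          ← add_mul, Nat.add_sub_cancel' hi']
      rw [← hd]
      exact hm

theorem degree_lt_of_degree_lt_succ {p : S[X]} {m : ℕ} (h : p.degree < ((m + 1 : ℕ) : WithBot ℕ))
    (hc : p.coeff m = 0) : p.degree < (m : WithBot ℕ) := by
  rw [degree_lt_iff_coeff_zero] at h ⊢
  intro i hi
  rcases hi.eq_or_lt with rfl | hi
  · exact hc
  · exact h i hi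

theorem monic_add_of_degree_lt_natDegree [Nontrivial S] {P d : S[X]} (hP : P.Monic) {N : ℕ}
    (hN : P.natDegree = N) (hd : d.degree < (N : WithBot ℕ)) :
    (P + d).Monic ∧ (P + d).natDegree = N := by
  have h : d.degree < P.degree := by rwa [degree_eq_natDegree hP.ne_zero, hN]
  exact ⟨hP.add_of_left h, by rw [natDegree_add_eq_left_of_degree_lt h, hN]⟩

/-- Existence of approximate roots. -/
theorem exists_approximate_root [Algebra ℚ S] [Nontrivial S] {Q : S[X]} (hQ : Q.Monic) {b N : ℕ}
    (hQN : Q.natDegree = (b + 1) * N) :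
    ∃ P : S[X], P.Monic ∧ P.natDegree = N ∧
      (Q - P ^ (b + 1)).degree < ((b * N : ℕ) : WithBot ℕ) := by
  suffices h : ∀ i ≤ N, ∃ P : S[X], P.Monic ∧ P.natDegree = N ∧
      (Q - P ^ (b + 1)).degree < ((b * N + (N - i) : ℕ) : WithBot ℕ) by
    simpa using h N le_rfl
  intro i hi
  induction i with
  | zero =>
    refine ⟨X ^ N, monic_X_pow N, natDegree_X_pow N, ?_⟩
    have hm : (((X : S[X]) ^ N) ^ (b + 1)).Monic := (monic_X_pow N).pow _
    have hd : (((X : S[X]) ^ N) ^ (b + 1)).natDegree = (b + 1) * N := by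
      rw [(monic_X_pow N).natDegree_pow, natDegree_X_pow]
    have := degree_sub_lt_left (p := Q) (q := (X ^ N) ^ (b + 1))
      (by rw [degree_eq_natDegree hQ.ne_zero, degree_eq_natDegree hm.ne_zero, hQN, hd])
      hQ.ne_zero (by rw [hQ.leadingCoeff, hm.leadingCoeff])
    rw [degree_eq_natDegree hQ.ne_zero, hQN, add_mul, one_mul] at this
    simpa using this
  | succ i ih =>
    obtain ⟨P, hP, hPN, hdeg⟩ := ih (by omega)
    set m := N - (i + 1) with hm
    have hmN : N - i = m + 1 := by omega
    rw [hmN, ← add_assoc] at hdeg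
    set c := (Q - P ^ (b + 1)).coeff (b * N + m) with hc
    set r : S := algebraMap ℚ S ((b + 1 : ℕ) : ℚ)⁻¹ with hr
    have hrb : r * ((b + 1 : ℕ) : S) = 1 := by
      rw [hr, ← map_natCast (algebraMap ℚ S), ← map_mul, inv_mul_cancel₀ (by positivity), map_one]
    have hdd : (C (r * c) * X ^ m : S[X]).degree < (N : WithBot ℕ) :=
      (degree_C_mul_X_pow_le _ _).trans_lt (by norm_cast; omega)
    obtain ⟨hP', hPN'⟩ := monic_add_of_degree_lt_natDegree hP hPN hdd
    refine ⟨_, hP', hPN', ?_⟩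
    obtain ⟨K, hK, hKd, hKc⟩ := exists_cofactor_pow_sub_pow hP' hP hPN' hPN b
    have heq : Q - (P + C (r * c) * X ^ m) ^ (b + 1) =
        (Q - P ^ (b + 1)) - C (r * c) * (K * X ^ m) := by
      rw [add_sub_cancel_left] at hK
      rw [← mul_assoc, mul_right_comm, ← hK]; ring
    rw [heq]
    apply degree_lt_of_degree_lt_succ
    · refine (degree_sub_le _ _).trans_lt (max_lt hdeg ?_)
      refine (degree_le_of_natDegree_le (n := b * N + m) ?_).trans_lt
        (by norm_cast; exact Nat.lt_succ_self _)
      refine (natDegree_C_mul_le _ _).trans (natDegree_mul_le_of_le hKd (natDegree_X_pow_le m))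
    · rw [coeff_sub, ← hc, coeff_C_mul, coeff_mul_X_pow, hKc, mul_right_comm, hrb, one_mul,
        sub_self]

end Expansion

section Val

variable {Γ : Type*} [LinearOrderedCommGroupWithZero Γ]

theorem Valuation.exists_map_sum_eq_of_distinct {A ι : Type*} [Ring A] (v : Valuation A Γ)
    {s : Finset ι} (hs : s.Nonempty) (f : ι → A)
    (hf : ∀ i ∈ s, ∀ j ∈ s, v (f i) ≠ 0 → v (f i) = v (f j) → i = j) :
    ∃ j ∈ s, v (∑ i ∈ s, f i) = v (f j) ∧ ∀ i ∈ s, v (f i) ≤ v (f j) := by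
  classical
  obtain ⟨j, hj, hmax⟩ := s.exists_max_image (fun i => v (f i)) hs
  refine ⟨j, hj, ?_, hmax⟩
  by_cases h0 : v (f j) = 0
  · rw [h0, ← le_zero_iff]
    exact v.map_sum_le fun i hi => h0 ▸ hmax i hi
  · refine v.map_sum_eq_of_lt hj (fun i hi => ?_)
    have hi' := Finset.mem_sdiff.1 hi
    refine lt_of_le_of_ne (hmax i hi'.1) fun h => hi'.2 ?_
    rw [Finset.mem_singleton]
    exact (hf j hj i hi'.1 h0 h.symm).symm

variable {k : Type*} [Field k] (v : Valuation k[X] Γ)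

theorem Valuation.exists_map_sum_mul_pow_eq {N : ℕ} {H : Subgroup Γˣ}
    (hH : ∀ p : k[X], p.degree < (N : WithBot ℕ) → v p ≠ 0 → ∃ u ∈ H, v p = (u : Γ))
    {G : k[X]} {δ : Γˣ} (hδ : v G = δ) {a : ℕ} (ha : 0 < a)
    (hδH : ∀ j, 0 < j → j < a → δ ^ j ∉ H)
    {e : ℕ → k[X]} (he : ∀ j, (e j).degree < (N : WithBot ℕ)) :
    ∃ j < a, v (∑ i ∈ Finset.range a, e i * G ^ i) = v (e j) * δ ^ j ∧
      ∀ i < a, v (e i) * δ ^ i ≤ v (e j) * (δ : Γ) ^ j := by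
  have key : ∀ i < a, ∀ j < a, v (e i) ≠ 0 → v (e i) * (δ : Γ) ^ i = v (e j) * δ ^ j →
      i ≤ j → i = j := by
    intro i _ j hj h0 h hij
    by_contra hne
    have h0' : v (e j) ≠ 0 := by
      rintro h'
      rw [h', zero_mul] at h
      exact mul_ne_zero h0 (pow_ne_zero _ δ.ne_zero) h
    obtain ⟨u, hu, hu'⟩ := hH _ (he i) h0
    obtain ⟨w, hw, hw'⟩ := hH _ (he j) h0'
    apply hδH (j - i) (by omega) (by omega)
    have h2 : u * δ ^ i = w * δ ^ j := by
      ext; push_cast; rw [← hu', ← hw', h]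
    have h3 : δ ^ (j - i) = w⁻¹ * u := by
      rw [← Nat.add_sub_cancel' hij, pow_add, mul_left_comm, mul_comm u] at h2
      rw [eq_inv_mul_iff_mul_eq]
      exact (mul_left_cancel h2).symm
    rw [h3]
    exact H.mul_mem (H.inv_mem hw) hu
  have hv : ∀ i, v (e i * G ^ i) = v (e i) * (δ : Γ) ^ i := fun i => by
    rw [map_mul, map_pow, hδ]
  obtain ⟨j, hj, h1, h2⟩ := v.exists_map_sum_eq_of_distinct
    (Finset.nonempty_range_iff.2 ha.ne') (fun i => e i * G ^ i) (by
      intro i hi j hj h0 h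
      rw [Finset.mem_range] at hi hj
      rw [hv] at h0 h
      rw [hv] at h
      rcases le_total i j with hij | hij
      · exact key i hi j hj (left_ne_zero_of_mul h0) h hij
      · rw [h] at h0
        exact (key j hj i hi (left_ne_zero_of_mul h0) h.symm hij).symm)
  refine ⟨j, Finset.mem_range.1 hj, by rw [h1, hv], fun i hi => ?_⟩
  have := h2 i (Finset.mem_range.2 hi)
  rwa [hv, hv] at this


theorem Valuation.exists_mem_eq_of_forall_mem_iff {N : ℕ} {H : Subgroup Γˣ}
    (hH : ∀ u : Γˣ, u ∈ H ↔ ∃ p : k[X], p.degree < (N : WithBot ℕ) ∧ v p = u)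
    (p : k[X]) (hp : p.degree < (N : WithBot ℕ)) (h0 : v p ≠ 0) : ∃ u ∈ H, v p = (u : Γ) :=
  ⟨Units.mk0 _ h0, (hH _).2 ⟨p, hp, rfl⟩, rfl⟩

/-- An approximate root has the same value as any monic polynomial of the same degree whose value
is new. -/
theorem Valuation.map_approximate_root_eq [CharZero k] (hnat : ∀ m : ℕ, m ≠ 0 → v (C (m : k)) = 1)
    {N : ℕ} {H : Subgroup Γˣ}
    (hH : ∀ p : k[X], p.degree < (N : WithBot ℕ) → v p ≠ 0 → ∃ u ∈ H, v p = (u : Γ))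
    {δ : Γˣ} {b : ℕ} (hb : 0 < b) (hδH : ∀ j, 0 < j → j < b + 1 → δ ^ j ∉ H)
    {P Q : k[X]} (hP : P.Monic) (hPN : P.natDegree = N)
    (hPQ : (Q - P ^ (b + 1)).degree < ((b * N : ℕ) : WithBot ℕ)) (hvQ : v Q ≤ δ ^ (b + 1))
    {G : k[X]} (hG : G.Monic) (hGN : G.natDegree = N) (hvG : v G = δ) : v P = δ := by
  have main : ∀ m ≤ N, ∀ G : k[X], G.Monic → G.natDegree = N → v G = δ →
      (G - P).degree < (m : WithBot ℕ) → v P = δ := by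
    intro m
    induction m with
    | zero =>
      intro _ G _ _ hvG hd
      have : G - P = 0 := by
        rw [← degree_eq_bot]
        simpa [Nat.WithBot.lt_zero_iff] using hd
      rw [← sub_eq_zero.1 this, hvG]
    | succ m ih =>
      intro hm G hG hGN hvG hd
      obtain ⟨K, hK, hKd, hKc⟩ := exists_cofactor_pow_sub_pow hG hP hGN hPN b
      have hQG : Q - G ^ (b + 1) = (Q - P ^ (b + 1)) - (G - P) * K := by rw [← hK]; ring
      have hGPd : (G - P).natDegree ≤ m :=
        natDegree_le_iff_coeff_eq_zero.2 fun i hi => (degree_lt_iff_coeff_zero _ _).1 hd i hi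
      have hQGd : (Q - G ^ (b + 1)).natDegree ≤ b * N + m := by
        rw [hQG]
        refine (natDegree_sub_le _ _).trans (max_le ?_ ?_)
        · exact (natDegree_le_of_degree_le hPQ.le).trans (Nat.le_add_right _ _)
        · rw [add_comm]; exact natDegree_mul_le_of_le hGPd hKd
      have hQGc : (Q - G ^ (b + 1)).coeff (b * N + m) = -((G - P).coeff m * (b + 1 : ℕ)) := by
        rw [hQG, coeff_sub, coeff_eq_zero_of_degree_lt (hPQ.trans_le (by norm_cast; omega)),
          add_comm, coeff_mul_add_eq_of_natDegree_le hGPd hKd, hKc, zero_sub]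
      obtain ⟨e, he, hsum⟩ := exists_expansion_of_monic hG hGN (b + 1) (p := Q - G ^ (b + 1))
        ((degree_le_of_natDegree_le hQGd).trans_lt (by norm_cast; rw [add_mul]; omega))
      have hlow := degree_sum_mul_pow_lt hG hGN b he
      have hGb := hG.natDegree_pow b
      rw [hGN] at hGb
      have hed : (e b).natDegree ≤ m := by
        have h1 : e b * G ^ b = (Q - G ^ (b + 1)) - ∑ j ∈ Finset.range b, e j * G ^ j := by
          rw [hsum, Finset.sum_range_succ]; ring
        have h2 : (e b * G ^ b).natDegree ≤ b * N + m := by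
          rw [h1]
          exact (natDegree_sub_le _ _).trans (max_le hQGd
            ((natDegree_le_of_degree_le hlow.le).trans (Nat.le_add_right _ _)))
        by_cases h0 : e b = 0
        · simp [h0]
        · rw [natDegree_mul h0 (hG.pow b).ne_zero, hGb] at h2
          omega
      have hec : (e b).coeff m = -((G - P).coeff m * (b + 1 : ℕ)) := by
        rw [← hQGc, hsum, Finset.sum_range_succ, coeff_add,
          coeff_eq_zero_of_degree_lt (hlow.trans_le (by norm_cast; omega)), zero_add,
          add_comm (b * N), coeff_mul_add_eq_of_natDegree_le hed hGb.le]
        have : (G ^ b).coeff (b * N) = 1 := by rw [← hGb]; exact hG.pow b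
        rw [this, mul_one]
      have hve : v (e b) < δ := by
        obtain ⟨j, _, hj, hmax⟩ := v.exists_map_sum_mul_pow_eq hH hvG b.succ_pos hδH he
        have h1 := hmax b b.lt_succ_self
        rw [← hj, ← hsum] at h1
        have h2 : v (Q - G ^ (b + 1)) ≤ (δ : Γ) ^ (b + 1) :=
          v.map_sub_le hvQ (by rw [map_pow, hvG])
        have h3 : v (e b) ≤ δ := by
          have := h1.trans h2
          rw [pow_succ'] at this
          exact le_of_mul_le_mul_right this (pow_pos (zero_lt_iff.2 δ.ne_zero) b)
        refine lt_of_le_of_ne h3 fun heq => ?_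
        obtain ⟨u, hu, hu'⟩ := hH _ (he b) (by rw [heq]; exact δ.ne_zero)
        rw [heq, Units.val_inj] at hu'
        exact hδH 1 one_pos (by omega) (by rw [pow_one, hu']; exact hu)
      have hb0 : ((b + 1 : ℕ) : k) ≠ 0 := Nat.cast_ne_zero.2 b.succ_ne_zero
      have hvr : v (C ((b + 1 : ℕ) : k)⁻¹) = 1 := by
        have h1 := hnat (b + 1) b.succ_ne_zero
        have h2 : v (C ((b + 1 : ℕ) : k)⁻¹) * v (C ((b + 1 : ℕ) : k)) = 1 := by
          rw [← map_mul, ← C_mul, inv_mul_cancel₀ hb0, C_1, map_one]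
        rwa [h1, mul_one] at h2
      have hdd : (C ((b + 1 : ℕ) : k)⁻¹ * e b).degree < (N : WithBot ℕ) :=
        (degree_C_mul (inv_ne_zero hb0)).trans_lt (he b)
      obtain ⟨hG', hGN'⟩ := monic_add_of_degree_lt_natDegree hG hGN hdd
      refine ih (by omega) _ hG' hGN' ?_ ?_
      · rw [v.map_add_eq_of_lt_left, hvG]
        rwa [map_mul, hvr, one_mul, hvG]
      · rw [add_sub_right_comm]
        apply degree_lt_of_degree_lt_succ
        · refine (degree_add_le _ _).trans_lt (max_lt hd ?_)
          refine (degree_C_mul (inv_ne_zero hb0)).trans_lt ((degree_le_of_natDegree_le hed).trans_lt ?_)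
          norm_cast; exact m.lt_succ_self
        · rw [coeff_add, coeff_C_mul, hec]
          field_simp
          ring
  refine main N le_rfl G hG hGN hvG ?_
  have h := degree_sub_lt_left (p := G) (q := P)
    (by rw [degree_eq_natDegree hG.ne_zero, degree_eq_natDegree hP.ne_zero, hGN, hPN])
    hG.ne_zero (by rw [hG.leadingCoeff, hP.leadingCoeff])
  rwa [degree_eq_natDegree hG.ne_zero, hGN] at h

theorem Valuation.mem_sup_zpowers_iff {N : ℕ} {H : Subgroup Γˣ}
    (hH : ∀ u : Γˣ, u ∈ H ↔ ∃ p : k[X], p.degree < (N : WithBot ℕ) ∧ v p = u)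
    {δ : Γˣ} {b : ℕ} (hδH : ∀ j, 0 < j → j < b + 1 → δ ^ j ∉ H) (hδ : δ ^ (b + 1) ∈ H)
    {G : k[X]} (hG : G.Monic) (hGN : G.natDegree = N) (hvG : v G = δ) (u : Γˣ) :
    u ∈ H ⊔ Subgroup.zpowers δ ↔
      ∃ p : k[X], p.degree < (((b + 1) * N : ℕ) : WithBot ℕ) ∧ v p = u := by
  constructor
  · intro hu
    obtain ⟨h, hh, w, hw, rfl⟩ := Subgroup.mem_sup.1 hu
    obtain ⟨z, rfl⟩ := Subgroup.mem_zpowers_iff.1 hw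
    have hb1 : ((b + 1 : ℕ) : ℤ) ≠ 0 := by positivity
    obtain ⟨j, hj⟩ := Int.eq_ofNat_of_zero_le (Int.emod_nonneg z hb1)
    have hjb : j < b + 1 := by
      have := Int.emod_lt_of_pos z (b := ((b + 1 : ℕ) : ℤ)) (by positivity)
      omega
    have hmem : h * (δ ^ (b + 1)) ^ (z / ((b + 1 : ℕ) : ℤ)) ∈ H :=
      H.mul_mem hh (H.zpow_mem hδ _)
    obtain ⟨e, he, hve⟩ := (hH _).1 hmem
    refine ⟨e * G ^ j, ?_, ?_⟩
    · have := degree_sum_mul_pow_lt hG hGN (b + 1)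
        (e := fun i => if i = j then e else 0) (fun i => by
          split_ifs
          · exact he
          · rw [degree_zero]; exact WithBot.bot_lt_coe _)
      simpa [hjb] using this
    · rw [map_mul, map_pow, hve, hvG, ← Units.val_pow_eq_pow_val, ← Units.val_mul, Units.val_inj,
        mul_assoc]
      congr 1
      rw [← zpow_natCast δ (b + 1), ← zpow_mul, ← zpow_natCast δ j, ← zpow_add, ← hj,
        Int.mul_ediv_add_emod]
  · rintro ⟨p, hp, hvp⟩
    obtain ⟨e, he, rfl⟩ := exists_expansion_of_monic hG hGN (b + 1) hp
    obtain ⟨j, _, hj, _⟩ := v.exists_map_sum_mul_pow_eq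
      (v.exists_mem_eq_of_forall_mem_iff hH) hvG b.succ_pos hδH he
    rw [hj] at hvp
    obtain ⟨w, hw, hw'⟩ := v.exists_mem_eq_of_forall_mem_iff hH _ (he j) (by
      intro h0
      rw [h0, zero_mul] at hvp
      exact u.ne_zero hvp.symm)
    rw [hw', ← Units.val_pow_eq_pow_val, ← Units.val_mul, Units.val_inj] at hvp
    rw [← hvp]
    exact Subgroup.mul_mem_sup hw (Subgroup.npow_mem_zpowers δ j)

variable {R : Type*} [CommRing R] [Algebra ℚ R] (ι : R →+* k)

theorem Valuation.exists_approximate_root_of_new_value [CharZero k]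
    (hnat : ∀ m : ℕ, m ≠ 0 → v (C (m : k)) = 1) {N : ℕ} {H : Subgroup Γˣ}
    (hH : ∀ u : Γˣ, u ∈ H ↔ ∃ p : k[X], p.degree < (N : WithBot ℕ) ∧ v p = u)
    {δ : Γˣ} {b : ℕ} (hb : 0 < b) (hδH : ∀ j, 0 < j → j < b + 1 → δ ^ j ∉ H)
    (hδ : δ ^ (b + 1) ∈ H)
    {G : k[X]} (hG : G.Monic) (hGN : G.natDegree = N) (hvG : v G = δ)
    {Q : R[X]} (hQ : Q.Monic) (hQN : Q.natDegree = (b + 1) * N)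
    (hvQ : ∀ u ∈ H ⊔ Subgroup.zpowers δ, v (Q.map ι) ≠ (u : Γ))
    (hval : ∀ u ∈ H ⊔ Subgroup.zpowers δ, (1 : Γ) ≤ (u : Γ) →
      ∃ p : R[X], p.degree < (((b + 1) * N : ℕ) : WithBot ℕ) ∧ v (p.map ι) = u) :
    ∃ P : R[X], P.Monic ∧ P.natDegree = N ∧ v (P.map ι) = δ ∧
      ∀ u ∈ H ⊔ Subgroup.zpowers δ, (1 : Γ) ≤ (u : Γ) →
        ∃ e : R[X], e.degree < (N : WithBot ℕ) ∧
          ∃ j < b + 1, v (e.map ι) * (δ : Γ) ^ j = u := by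
  have : Nontrivial R := ι.domain_nontrivial
  obtain ⟨P, hP, hPN, hPQ⟩ := exists_approximate_root hQ hQN
  have hvP : v (P.map ι) = δ := by
    refine v.map_approximate_root_eq hnat (v.exists_mem_eq_of_forall_mem_iff hH) hb hδH
      (hP.map ι) (by rw [hP.natDegree_map, hPN]) (Q := Q.map ι) ?_ ?_ hG hGN hvG
    · rw [← Polynomial.map_pow, ← Polynomial.map_sub]
      exact degree_map_le.trans_lt hPQ
    · by_contra! hlt
      have h1 : v (Q.map ι - G ^ (b + 1)) = v (Q.map ι) :=
        v.map_sub_eq_of_lt_left (by rwa [map_pow, hvG])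
      have hQm := hQ.map ι
      have hQd : (Q.map ι).degree = (((b + 1) * N : ℕ) : WithBot ℕ) := by
        rw [degree_eq_natDegree hQm.ne_zero, hQ.natDegree_map, hQN]
      have hGm := hG.pow (b + 1)
      have hd := degree_sub_lt_left (p := Q.map ι) (q := G ^ (b + 1))
        (by rw [hQd, degree_eq_natDegree hGm.ne_zero, hG.natDegree_pow, hGN])
        hQm.ne_zero (by rw [hQm.leadingCoeff, hGm.leadingCoeff])
      rw [hQd] at hd
      have h0 : v (Q.map ι) ≠ 0 := ((zero_le (a := (δ : Γ) ^ (b + 1))).trans_lt hlt).ne'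
      exact hvQ (Units.mk0 _ h0)
        ((v.mem_sup_zpowers_iff hH hδH hδ hG hGN hvG _).2 ⟨_, hd, h1⟩) rfl
  refine ⟨P, hP, hPN, hvP, fun u hu h1 => ?_⟩
  obtain ⟨p, hp, hvp⟩ := hval u hu h1
  obtain ⟨e, he, rfl⟩ := exists_expansion_of_monic hP hPN (b + 1) hp
  obtain ⟨j, hj, hvj, _⟩ := v.exists_map_sum_mul_pow_eq
    (v.exists_mem_eq_of_forall_mem_iff hH) hvP b.succ_pos hδH (e := fun i => (e i).map ι)
    (fun i => degree_map_le.trans_lt (he i))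
  refine ⟨e j, he j, j, hj, ?_⟩
  rw [← hvp, ← hvj]
  simp [Polynomial.map_sum]

theorem exists_order_of_pow_mem {H : Subgroup Γˣ} {δ : Γˣ} (hδ : δ ∉ H) {n : ℕ} (hn : 0 < n)
    (h : δ ^ n ∈ H) :
    ∃ b, 0 < b ∧ (∀ j, 0 < j → j < b + 1 → δ ^ j ∉ H) ∧ δ ^ (b + 1) ∈ H := by
  classical
  have hex : ∃ j, 0 < j ∧ δ ^ j ∈ H := ⟨n, hn, h⟩
  obtain ⟨h0, hm⟩ := Nat.find_spec hex
  have h1 : Nat.find hex ≠ 1 := fun h1 => hδ (by rwa [h1, pow_one] at hm)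
  refine ⟨Nat.find hex - 1, by omega, fun j hj hjb hmem => ?_, by rwa [Nat.sub_add_cancel h0]⟩
  exact Nat.find_min hex (m := j) (by omega) ⟨hj, hmem⟩

theorem Valuation.succ_mul_le_of_map_eq_zero {n : ℕ}
    (hinj : ∀ p : k[X], p ≠ 0 → p.degree < (n : WithBot ℕ) → v p ≠ 0)
    {F : k[X]} (hF : F.Monic) (hFn : F.natDegree = n) (hvF : v F = 0)
    {N : ℕ} (hNn : N ≤ n) {H : Subgroup Γˣ}
    (hH : ∀ p : k[X], p.degree < (N : WithBot ℕ) → v p ≠ 0 → ∃ u ∈ H, v p = (u : Γ))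
    {G : k[X]} (hG : G.Monic) (hGN : G.natDegree = N)
    {δ : Γˣ} (hvG : v G = δ) {a : ℕ} (ha : 0 < a) (hδH : ∀ j, 0 < j → j < a → δ ^ j ∉ H) :
    a * N ≤ n := by
  by_contra! hlt
  obtain ⟨e, he, hsum⟩ := exists_expansion_of_monic hG hGN a (p := F)
    (by rw [degree_eq_natDegree hF.ne_zero, hFn]; exact_mod_cast hlt)
  obtain ⟨j, _, hj, hmax⟩ := v.exists_map_sum_mul_pow_eq hH hvG ha hδH he
  rw [← hsum, hvF] at hj
  apply hF.ne_zero
  rw [hsum]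
  refine Finset.sum_eq_zero fun i hi => ?_
  have h1 := hmax i (Finset.mem_range.1 hi)
  rw [← hj, le_zero_iff] at h1
  have h2 : v (e i) = 0 := (mul_eq_zero.1 h1).resolve_right (pow_ne_zero _ δ.ne_zero)
  have h3 : e i = 0 := by
    by_contra h0
    exact hinj _ h0 ((he i).trans_le (by exact_mod_cast hNn)) h2
  rw [h3, zero_mul]

theorem Valuation.exists_monic_new_value_and_values [CharZero k]
    (hnat : ∀ m : ℕ, m ≠ 0 → v (C (m : k)) = 1) {n : ℕ} (hn : 0 < n)
    (hinj : ∀ p : k[X], p ≠ 0 → p.degree < (n : WithBot ℕ) → v p ≠ 0)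
    (hpow : ∀ u : Γˣ, ∃ c : k, v (C c) = (u : Γ) ^ n)
    (hnew : ∀ (N : ℕ) (H : Subgroup Γˣ), N < n →
      (∀ u : Γˣ, u ∈ H ↔ ∃ p : k[X], p.degree < (N : WithBot ℕ) ∧ v p = u) →
      ∃ G : k[X], G.Monic ∧ G.natDegree = N ∧ ∃ δ ∉ H, v G = (δ : Γ))
    {F : R[X]} (hF : F.Monic) (hFn : F.natDegree = n) (hvF : v (F.map ι) = 0)
    (hval : ∀ u : Γˣ, (1 : Γ) ≤ u →
      ∃ p : R[X], p.degree < (n : WithBot ℕ) ∧ v (p.map ι) = u)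
    (N : ℕ) (hN : 0 < N) (hNn : N ≤ n) (H : Subgroup Γˣ)
    (hH : ∀ u : Γˣ, u ∈ H ↔ ∃ p : k[X], p.degree < (N : WithBot ℕ) ∧ v p = u) :
    (∃ P : R[X], P.Monic ∧ P.natDegree = N ∧ ∀ u ∈ H, v (P.map ι) ≠ (u : Γ)) ∧
      ∀ u ∈ H, (1 : Γ) ≤ (u : Γ) →
        ∃ p : R[X], p.degree < (N : WithBot ℕ) ∧ v (p.map ι) = u := by
  induction hd : n - N using Nat.strong_induction_on generalizing N H with
  | _ d ih =>
  rcases hNn.eq_or_lt with rfl | hlt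
  · exact ⟨⟨F, hF, hFn, fun u _ => by rw [hvF]; exact u.ne_zero.symm⟩, fun u _ h1 => hval u h1⟩
  have : Nontrivial R := ι.domain_nontrivial
  obtain ⟨G, hG, hGN, δ, hδ, hvG⟩ := hnew N H hlt hH
  have hδn : δ ^ n ∈ H := by
    obtain ⟨c, hc⟩ := hpow δ
    refine (hH _).2 ⟨C c, degree_C_le.trans_lt (by exact_mod_cast hN), ?_⟩
    rw [hc, Units.val_pow_eq_pow_val]
  obtain ⟨b, hb, hδH, hδb⟩ := exists_order_of_pow_mem hδ hn hδn
  have hle : (b + 1) * N ≤ n := v.succ_mul_le_of_map_eq_zero hinj (hF.map ι)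
    (by rw [hF.natDegree_map, hFn]) hvF hNn (v.exists_mem_eq_of_forall_mem_iff hH) hG hGN hvG
    b.succ_pos hδH
  have hgt : N < (b + 1) * N := by nlinarith
  obtain ⟨⟨Q, hQ, hQN, hvQ⟩, hvals⟩ := ih (n - (b + 1) * N) (by omega) ((b + 1) * N)
    (by omega) hle (H ⊔ Subgroup.zpowers δ) (v.mem_sup_zpowers_iff hH hδH hδb hG hGN hvG) rfl
  obtain ⟨P, hP, hPN, hvP, hexp⟩ := v.exists_approximate_root_of_new_value ι hnat hH hb hδH hδb
    hG hGN hvG hQ hQN hvQ hvals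
  refine ⟨⟨P, hP, hPN, fun u hu h => ?_⟩, fun u hu h1 => ?_⟩
  · rw [hvP, Units.val_inj] at h
    exact hδ (h ▸ hu)
  · obtain ⟨e, he, j, hj, hej⟩ := hexp u (Subgroup.mem_sup_left hu) h1
    rcases Nat.eq_zero_or_pos j with rfl | hj0
    · exact ⟨e, he, by simpa using hej⟩
    · exfalso
      obtain ⟨w, hw, hw'⟩ := v.exists_mem_eq_of_forall_mem_iff hH (e.map ι)
        (degree_map_le.trans_lt he) (by
          intro h0
          rw [h0, zero_mul] at hej
          exact u.ne_zero hej.symm)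
      rw [hw', ← Units.val_pow_eq_pow_val, ← Units.val_mul, Units.val_inj] at hej
      apply hδH j hj0 hj
      rw [← inv_mul_cancel_left w (δ ^ j), hej]
      exact H.mul_mem (H.inv_mem hw) hu

/-- `T` represents, up to values of constants, all the nonzero values of polynomials of degree less
than `M`. -/
def Valuation.Covers (v : Valuation k[X] Γ) (M : ℕ) (T : Finset Γ) : Prop :=
  ∀ p : k[X], p.degree < (M : WithBot ℕ) → v p ≠ 0 → ∃ t ∈ T, ∃ c : k, v p = v (C c) * t

variable {v}

theorem Valuation.Covers.succ_of_monic {M : ℕ} {T : Finset Γ} (hT : v.Covers M T)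
    (h : ∀ p : k[X], p.Monic → p.natDegree = M → v p ≠ 0 → ∃ t ∈ T, ∃ c : k, v p = v (C c) * t) :
    v.Covers (M + 1) T := by
  intro p hp h0
  by_cases hlt : p.degree < (M : WithBot ℕ)
  · exact hT p hlt h0
  have hp0 : p ≠ 0 := by rintro rfl; exact h0 (map_zero v)
  have hM : p.natDegree = M := by
    rw [degree_eq_natDegree hp0] at hp hlt
    norm_cast at hp hlt
    omega
  have hl : p.leadingCoeff ≠ 0 := leadingCoeff_ne_zero.2 hp0
  have heq : p = C p.leadingCoeff * (p * C p.leadingCoeff⁻¹) := by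
    rw [mul_left_comm, ← C_mul, mul_inv_cancel₀ hl, C_1, mul_one]
  have hv : v p = v (C p.leadingCoeff) * v (p * C p.leadingCoeff⁻¹) := by
    rw [← map_mul, ← heq]
  obtain ⟨t, ht, c, hc⟩ := h (p * C p.leadingCoeff⁻¹) (monic_mul_leadingCoeff_inv hp0)
    (by rw [natDegree_mul_C (inv_ne_zero hl), hM])
    (fun h => h0 (by rw [hv, h, mul_zero]))
  exact ⟨t, ht, p.leadingCoeff * c, by rw [hv, hc, C_mul, map_mul, mul_assoc]⟩

theorem Valuation.Covers.exists_succ {M : ℕ} {T : Finset Γ} (hT : v.Covers M T) :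
    ∃ T' : Finset Γ, T'.card ≤ T.card + 1 ∧ v.Covers (M + 1) T' := by
  classical
  by_cases h : ∀ p : k[X], p.Monic → p.natDegree = M → v p ≠ 0 →
      ∃ t ∈ T, ∃ c : k, v p = v (C c) * t
  · exact ⟨T, Nat.le_succ _, hT.succ_of_monic h⟩
  push Not at h
  obtain ⟨q, hq, hqM, -, hqT⟩ := h
  refine ⟨insert (v q) T, Finset.card_insert_le _ _, ?_⟩
  refine Valuation.Covers.succ_of_monic (fun p hp h0 => ?_) fun p hp hpM h0 => ?_
  · obtain ⟨t, ht, hc⟩ := hT p hp h0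
    exact ⟨t, Finset.mem_insert_of_mem ht, hc⟩
  by_cases hpq : v p = v q
  · exact ⟨v q, Finset.mem_insert_self _ _, 1, by rw [C_1, map_one, one_mul, hpq]⟩
  have hd := degree_sub_lt_left (p := p) (q := q)
    (by rw [degree_eq_natDegree hp.ne_zero, degree_eq_natDegree hq.ne_zero, hpM, hqM])
    hp.ne_zero (by rw [hp.leadingCoeff, hq.leadingCoeff])
  rw [degree_eq_natDegree hp.ne_zero, hpM] at hd
  rcases lt_or_gt_of_ne hpq with hlt | hlt
  · have hv := v.map_sub_eq_of_lt_right hlt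
    obtain ⟨t, ht, c, hc⟩ := hT _ hd (by rw [hv]; exact (zero_le.trans_lt hlt).ne')
    exact absurd (hv.symm.trans hc) (hqT t ht c)
  · have hv := v.map_sub_eq_of_lt_left hlt
    obtain ⟨t, ht, c, hc⟩ := hT _ hd (by rw [hv]; exact h0)
    exact ⟨t, Finset.mem_insert_of_mem ht, c, hv.symm.trans hc⟩

theorem Valuation.Covers.exists_add {M : ℕ} {T : Finset Γ} (hT : v.Covers M T) (i : ℕ) :
    ∃ T' : Finset Γ, T'.card ≤ T.card + i ∧ v.Covers (M + i) T' := by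
  induction i with
  | zero => exact ⟨T, le_rfl, hT⟩
  | succ i ih =>
    obtain ⟨T', h, hT'⟩ := ih
    obtain ⟨T'', h', hT''⟩ := hT'.exists_succ
    exact ⟨T'', by omega, hT''⟩

theorem Valuation.covers_zero : v.Covers 0 ∅ := by
  intro p hp h0
  have : p = 0 := by
    rw [← degree_eq_bot]
    simpa [Nat.WithBot.lt_zero_iff] using hp
  exact absurd (by rw [this, map_zero]) h0

theorem Valuation.map_ne_zero_of_degree_lt {n : ℕ}
    (hcount : ∀ T : Finset Γ, (∀ u : Γˣ, ∃ t ∈ T, ∃ c : k, (u : Γ) = v (C c) * t) → n ≤ T.card)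
    (hsurj : ∀ u : Γˣ, ∃ p : k[X], v p = u) (p : k[X]) (hp : p ≠ 0)
    (hpn : p.degree < (n : WithBot ℕ)) : v p ≠ 0 := by
  intro h0
  set q := p * C p.leadingCoeff⁻¹ with hq
  have hqm : q.Monic := monic_mul_leadingCoeff_inv hp
  have hqd : q.degree = (p.natDegree : WithBot ℕ) := by
    rw [degree_eq_natDegree hqm.ne_zero, hq,
      natDegree_mul_C (inv_ne_zero (leadingCoeff_ne_zero.2 hp))]
  have hvq : v q = 0 := by rw [hq, map_mul, h0, zero_mul]
  obtain ⟨T, hTc, hT⟩ := (Valuation.covers_zero (v := v)).exists_add p.natDegree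
  rw [zero_add] at hT
  have hle : n ≤ T.card := hcount T fun u => by
    obtain ⟨r, hr⟩ := hsurj u
    have hmod : v (r %ₘ q) = u := by
      rw [← hr]
      conv_rhs => rw [← modByMonic_add_div r q]
      rw [v.map_add_of_right_eq_zero (by rw [map_mul, hvq, zero_mul])]
    rw [← hmod]
    exact hT _ (hqd ▸ degree_modByMonic_lt _ hqm) (by rw [hmod]; exact u.ne_zero)
  rw [degree_eq_natDegree hp] at hpn
  norm_cast at hpn
  simp only [Finset.card_empty] at hTc
  omega

theorem Valuation.exists_monic_new_value {n : ℕ}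
    (hcount : ∀ T : Finset Γ, (∀ u : Γˣ, ∃ t ∈ T, ∃ c : k, (u : Γ) = v (C c) * t) → n ≤ T.card)
    (hsurj : ∀ u : Γˣ, ∃ p : k[X], p.degree < (n : WithBot ℕ) ∧ v p = u)
    (N : ℕ) (H : Subgroup Γˣ) (hN : N < n)
    (hH : ∀ u : Γˣ, u ∈ H ↔ ∃ p : k[X], p.degree < (N : WithBot ℕ) ∧ v p = u) :
    ∃ G : k[X], G.Monic ∧ G.natDegree = N ∧ ∃ δ ∉ H, v G = (δ : Γ) := by
  by_contra! hcon
  obtain ⟨T, hTc, hT⟩ := (Valuation.covers_zero (v := v)).exists_add N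
  rw [zero_add] at hT
  have hT1 : v.Covers (N + 1) T := hT.succ_of_monic fun p hp hpN h0 => by
    have hmem : Units.mk0 (v p) h0 ∈ H := by
      by_contra hnot
      exact hcon p hp hpN _ hnot rfl
    obtain ⟨q, hq, hvq⟩ := (hH _).1 hmem
    have hvq : v q = v p := hvq
    rw [← hvq]
    exact hT q hq (by rwa [hvq])
  obtain ⟨T', hTc', hT'⟩ := hT1.exists_add (n - (N + 1))
  rw [Nat.add_sub_cancel' hN] at hT'
  have := hcount T' fun u => by
    obtain ⟨p, hp, hvp⟩ := hsurj u
    rw [← hvp]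
    exact hT' p hp (by rw [hvp]; exact u.ne_zero)
  simp only [Finset.card_empty] at hTc
  omega

end Val

section Epimorphism

variable {K : Type*} [Field K]

theorem exists_eq_sum_comp_mul_X_pow {f : K[X]} (hf : 0 < f.natDegree) (p : K[X]) :
    ∃ c : Fin f.natDegree → K[X], p = ∑ i, (c i).comp f * X ^ (i : ℕ) := by
  have hf0 : f ≠ 0 := by rintro rfl; simp at hf
  induction hd : p.natDegree using Nat.strong_induction_on generalizing p with
  | _ d ih =>
  have hlow : ∀ r : K[X], r.degree < f.degree →
      r = ∑ i : Fin f.natDegree, (C (r.coeff i)).comp f * X ^ (i : ℕ) := by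
    intro r hr
    by_cases h0 : r = 0
    · simp [h0]
    have hr' : r.natDegree < f.natDegree := natDegree_lt_natDegree h0 hr
    simp only [C_comp]
    rw [Fin.sum_univ_eq_sum_range (fun i => C (r.coeff i) * X ^ i)]
    exact as_sum_range_C_mul_X_pow' r hr'
  by_cases hpf : p.degree < f.degree
  · exact ⟨_, hlow p hpf⟩
  have hpd : f.natDegree ≤ p.natDegree := natDegree_le_natDegree (not_lt.1 hpf)
  have hp0 : p ≠ 0 := by
    rintro rfl
    rw [natDegree_zero] at hpd
    omega
  obtain ⟨c, hc⟩ := ih (p / f).natDegree (hd ▸ natDegree_lt_natDegree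
    (fun h => hpf ((Polynomial.div_eq_zero_iff hf0).1 h)) (degree_div_lt hp0 (natDegree_pos_iff_degree_pos.1 hf))) (p / f) rfl
  refine ⟨fun i => X * c i + C ((p % f).coeff i), ?_⟩
  conv_lhs => rw [← EuclideanDomain.div_add_mod p f, hlow (p % f) (degree_mod_lt p hf0), hc,
    Finset.mul_sum, ← Finset.sum_add_distrib]
  refine Finset.sum_congr rfl fun i _ => ?_
  rw [add_comp, mul_comp, X_comp]
  ring

/-- Two polynomials `f` and `g` satisfy an algebraic relation which is monic in `g`, of degree
`deg f`. -/
theorem exists_monic_relation {f : K[X]} (hf : 0 < f.natDegree) (g : K[X]) :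
    ∃ F : K[X][X], F.Monic ∧ F.natDegree = f.natDegree ∧ F.eval₂ (compRingHom f) g = 0 := by
  choose c hc using fun j : Fin f.natDegree => exists_eq_sum_comp_mul_X_pow hf (g * X ^ (j : ℕ))
  let M : Matrix (Fin f.natDegree) (Fin f.natDegree) K[X] := Matrix.of c
  refine ⟨M.charpoly, M.charpoly_monic, by rw [M.charpoly_natDegree_eq_dim, Fintype.card_fin], ?_⟩
  rw [← eval_map, ← Matrix.charpoly_map, Matrix.eval_charpoly, ← Matrix.exists_mulVec_eq_zero_iff]
  refine ⟨fun i => X ^ (i : ℕ), fun h => ?_, ?_⟩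
  · have := congrFun h ⟨0, hf⟩
    simp at this
  · ext1 j
    rw [Matrix.sub_mulVec, Pi.sub_apply, Pi.zero_apply, sub_eq_zero]
    simp only [Matrix.scalar_apply, Matrix.mulVec_diagonal, hc j]
    rfl

open WithZero

theorem exists_comap_infty_valuation [CharZero K] {f g : K[X]} (hf : 0 < f.natDegree) (hg : g ≠ 0) :
    ∃ v : Valuation (RatFunc K)[X] ℤᵐ⁰,
      (∀ p : K[X][X], p.eval₂ (compRingHom f) g = 0 → v (p.map (algebraMap K[X] (RatFunc K))) = 0) ∧
      (∀ p : K[X][X], p.eval₂ (compRingHom f) g ≠ 0 → v (p.map (algebraMap K[X] (RatFunc K))) =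
        exp ((p.eval₂ (compRingHom f) g).natDegree : ℤ)) ∧
      v X = exp (g.natDegree : ℤ) ∧
      (∀ c : RatFunc K, c ≠ 0 → ∃ z : ℤ, v (C c) = exp (f.natDegree * z)) ∧
      (∀ z : ℤ, ∃ c : RatFunc K, v (C c) = exp (f.natDegree * z)) ∧
      ∀ m : ℕ, m ≠ 0 → v (C (m : RatFunc K)) = 1 := by
  classical
  have hf0 : f ≠ 0 := by rintro rfl; simp at hf
  let α := algebraMap K[X] (RatFunc K)
  have hα : Function.Injective α := IsFractionRing.injective K[X] (RatFunc K)
  have hinj : Function.Injective (α.comp (compRingHom f)) := by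
    refine hα.comp ((injective_iff_map_eq_zero _).2 fun p hp => ?_)
    rw [coe_compRingHom_apply] at hp
    rcases comp_eq_zero_iff.1 hp with h | ⟨_, h⟩
    · exact h
    · rw [h, natDegree_C] at hf; exact absurd hf (lt_irrefl _)
  let φ : RatFunc K →+* RatFunc K := IsFractionRing.lift hinj
  have hφ : ∀ p, φ (α p) = α (p.comp f) := fun p => by
    rw [← coe_compRingHom_apply]
    exact IsFractionRing.lift_algebraMap hinj p
  have hw : ∀ p : K[X], p ≠ 0 → RatFunc.inftyValuation K (α p) = exp (p.natDegree : ℤ) :=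
    fun p hp => RatFunc.inftyValuation.polynomial K hp
  have hev : ∀ p : K[X][X], (p.map α).eval₂ φ (α g) = α (p.eval₂ (compRingHom f) g) := by
    intro p
    rw [eval₂_map, hom_eval₂]
    congr 1
    exact RingHom.ext hφ
  have hC : ∀ p : K[X], p ≠ 0 →
      RatFunc.inftyValuation K (φ (α p)) = exp ((f.natDegree : ℤ) * p.natDegree) := by
    intro p hp
    have h0 : p.comp f ≠ 0 := by
      intro h0
      apply hp
      apply hinj
      rw [map_zero, RingHom.comp_apply, coe_compRingHom_apply, h0, map_zero]
    rw [hφ, hw _ h0, natDegree_comp, mul_comm]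
    push_cast
    rfl
  have hvC : ∀ c, (RatFunc.inftyValuation K).comap (eval₂RingHom φ (α g)) (C c) =
      RatFunc.inftyValuation K (φ c) := fun c => by
    rw [Valuation.comap_apply, coe_eval₂RingHom, eval₂_C]
  refine ⟨(RatFunc.inftyValuation K).comap (eval₂RingHom φ (α g)), fun p hp => ?_, fun p hp => ?_,
    ?_, fun c hc => ?_, fun z => ?_, fun m hm => ?_⟩
  · rw [Valuation.comap_apply, coe_eval₂RingHom, hev, hp, map_zero, map_zero]
  · rw [Valuation.comap_apply, coe_eval₂RingHom, hev, hw _ hp]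
  · rw [Valuation.comap_apply, coe_eval₂RingHom, eval₂_X, hw g hg]
  · obtain ⟨p, q, hq, rfl⟩ := IsFractionRing.div_surjective (A := K[X]) c
    have hq0 : q ≠ 0 := nonZeroDivisors.ne_zero hq
    have hp0 : p ≠ 0 := by rintro rfl; simp at hc
    refine ⟨p.natDegree - q.natDegree, ?_⟩
    rw [hvC, map_div₀, map_div₀, hC p hp0, hC q hq0, mul_sub, exp_sub]
  · refine ⟨α X ^ z, ?_⟩
    rw [hvC, map_zpow₀, map_zpow₀, hC X X_ne_zero, ← exp_zsmul]
    simp [mul_comm]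
  · rw [hvC, map_natCast, ← map_natCast (RatFunc.C (K := K))]
    exact RatFunc.inftyValuation.C K (Nat.cast_ne_zero.2 hm)

theorem natDegree_dvd_of_lt_of_forall_exists_eval₂_eq [CharZero K] {f g : K[X]}
    (hf : 0 < f.natDegree) (hfg : f.natDegree < g.natDegree)
    (hgen : ∀ q : K[X], ∃ p : K[X][X], p.eval₂ (compRingHom f) g = q) :
    f.natDegree ∣ g.natDegree := by
  classical
  by_contra hndvd
  have hg0 : g ≠ 0 := by rintro rfl; simp at hfg
  obtain ⟨v, hv0, hv1, hvX, hC1, hC2, hnat⟩ := exists_comap_infty_valuation hf hg0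
  obtain ⟨F, hF, hFn, hF0⟩ := exists_monic_relation hf g
  set n := f.natDegree with hn
  set m := g.natDegree with hm
  set ι := algebraMap K[X] (RatFunc K) with hι
  have hunit : ∀ u : ℤᵐ⁰ˣ, ∃ z : ℤ, (u : ℤᵐ⁰) = exp z := fun u =>
    ⟨_, (exp_log u.ne_zero).symm⟩
  have hval : ∀ u : ℤᵐ⁰ˣ, (1 : ℤᵐ⁰) ≤ u →
      ∃ p : K[X][X], p.degree < (n : WithBot ℕ) ∧ v (p.map ι) = u := by
    intro u hu
    obtain ⟨z, hz⟩ := hunit u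
    rw [hz, ← exp_zero, exp_le_exp] at hu
    obtain ⟨j, rfl⟩ := Int.eq_ofNat_of_zero_le hu
    obtain ⟨p, hp⟩ := hgen (X ^ j)
    have hev : (p %ₘ F).eval₂ (compRingHom f) g = X ^ j := by
      rw [← hp]
      conv_rhs => rw [← modByMonic_add_div p F]
      rw [eval₂_add, eval₂_mul, hF0, zero_mul, add_zero]
    refine ⟨p %ₘ F, ?_, ?_⟩
    · have := degree_modByMonic_lt p hF
      rwa [degree_eq_natDegree hF.ne_zero, hFn] at this
    · rw [hv1 _ (by rw [hev]; exact pow_ne_zero _ X_ne_zero), hev, natDegree_X_pow, hz]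
  have hsurj : ∀ u : ℤᵐ⁰ˣ, ∃ p : (RatFunc K)[X], p.degree < (n : WithBot ℕ) ∧ v p = u := by
    intro u
    obtain ⟨z, hz⟩ := hunit u
    have hz0 : 0 ≤ z + n * |z| := by
      have h1 : |z| ≤ n * |z| := le_mul_of_one_le_left (abs_nonneg z) (by exact_mod_cast hf)
      have := neg_abs_le z
      linarith
    obtain ⟨p, hp, hvp⟩ := hval (Units.mk0 (exp (z + n * |z|)) exp_ne_zero)
      (by rw [Units.val_mk0, ← exp_zero, exp_le_exp]; exact hz0)
    obtain ⟨c, hc⟩ := hC2 (-|z|)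
    have hc0 : c ≠ 0 := by
      rintro rfl
      rw [C_0, map_zero] at hc
      exact exp_ne_zero hc.symm
    refine ⟨C c * p.map ι, ?_, ?_⟩
    · rw [degree_C_mul hc0]
      exact degree_map_le.trans_lt hp
    · rw [map_mul, hc, hvp, Units.val_mk0, ← exp_add, hz]
      congr 1
      ring
  have hcount : ∀ T : Finset ℤᵐ⁰, (∀ u : ℤᵐ⁰ˣ, ∃ t ∈ T, ∃ c : RatFunc K,
      (u : ℤᵐ⁰) = v (C c) * t) → n ≤ T.card := by
    intro T hT
    have hsub : Finset.Ico (0 : ℤ) n ⊆ T.image fun t => log t % (n : ℤ) := by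
      intro z hz
      rw [Finset.mem_Ico] at hz
      obtain ⟨t, ht, c, hc⟩ := hT (Units.mk0 (exp z) exp_ne_zero)
      rw [Units.val_mk0] at hc
      have ht0 : t ≠ 0 := by
        rintro rfl
        rw [mul_zero] at hc
        exact exp_ne_zero hc
      have hc0 : c ≠ 0 := by
        rintro rfl
        rw [C_0, map_zero, zero_mul] at hc
        exact exp_ne_zero hc
      obtain ⟨y, hy⟩ := hC1 c hc0
      have := congrArg log hc
      rw [hy, log_mul exp_ne_zero ht0, log_exp, log_exp] at this
      refine Finset.mem_image.2 ⟨t, ht, ?_⟩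
      rw [← Int.emod_eq_of_lt hz.1 hz.2, this, Int.mul_add_emod_self_left]
    have := (Finset.card_le_card hsub).trans Finset.card_image_le
    simpa using this
  have hinj : ∀ p : (RatFunc K)[X], p ≠ 0 → p.degree < (n : WithBot ℕ) → v p ≠ 0 :=
    Valuation.map_ne_zero_of_degree_lt hcount fun u => (hsurj u).imp fun _ h => h.2
  have hpow : ∀ u : ℤᵐ⁰ˣ, ∃ c : RatFunc K, v (C c) = (u : ℤᵐ⁰) ^ n := by
    intro u
    obtain ⟨z, hz⟩ := hunit u
    obtain ⟨c, hc⟩ := hC2 z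
    exact ⟨c, by rw [hc, hz, ← exp_nsmul, nsmul_eq_mul]⟩
  let H : Subgroup ℤᵐ⁰ˣ :=
    { carrier := {u | (n : ℤ) ∣ log (u : ℤᵐ⁰)}
      one_mem' := by simp
      mul_mem' := fun {a b} ha hb => by
        rw [Set.mem_ofPred_eq, Units.val_mul, log_mul a.ne_zero b.ne_zero]
        exact dvd_add ha hb
      inv_mem' := fun {a} ha => by
        rw [Set.mem_ofPred_eq, Units.val_inv_eq_inv_val, log_inv]
        exact (dvd_neg).2 ha }
  have hmemH : ∀ u : ℤᵐ⁰ˣ, u ∈ H ↔ (n : ℤ) ∣ log (u : ℤᵐ⁰) := fun u => Iff.rfl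
  have hH : ∀ u : ℤᵐ⁰ˣ, u ∈ H ↔
      ∃ p : (RatFunc K)[X], p.degree < ((1 : ℕ) : WithBot ℕ) ∧ v p = u := by
    intro u
    constructor
    · rintro ⟨z, hz⟩
      obtain ⟨c, hc⟩ := hC2 z
      refine ⟨C c, degree_C_le.trans_lt (by norm_num), ?_⟩
      rw [hc, ← hz, exp_log u.ne_zero]
    · rintro ⟨p, hp, hvp⟩
      have hpC : p = C (p.coeff 0) :=
        eq_C_of_natDegree_le_zero (natDegree_le_iff_coeff_eq_zero.2
          fun i hi => (degree_lt_iff_coeff_zero _ 1).1 hp i hi)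
      have hc0 : p.coeff 0 ≠ 0 := by
        intro h0
        rw [hpC, h0, C_0, map_zero] at hvp
        exact u.ne_zero hvp.symm
      obtain ⟨z, hz⟩ := hC1 _ hc0
      rw [hmemH, ← hvp, hpC, hz, log_exp]
      exact dvd_mul_right _ _
  let δ : ℤᵐ⁰ˣ := Units.mk0 (exp (m : ℤ)) exp_ne_zero
  have hvX' : v X = δ := hvX
  have hδ : δ ∉ H := by
    rw [hmemH, Units.val_mk0, log_exp, Int.natCast_dvd_natCast]
    exact hndvd
  have hδn : δ ^ n ∈ H := by
    rw [hmemH, Units.val_pow_eq_pow_val, log_pow, nsmul_eq_mul]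
    exact dvd_mul_right _ _
  obtain ⟨b, hb, hδH, hδb⟩ := exists_order_of_pow_mem hδ hf hδn
  have hle : (b + 1) * 1 ≤ n := v.succ_mul_le_of_map_eq_zero hinj (hF.map ι)
    (by rw [hF.natDegree_map, hFn]) (hv0 F hF0) hf (v.exists_mem_eq_of_forall_mem_iff hH) monic_X
    natDegree_X hvX' b.succ_pos hδH
  obtain ⟨⟨Q, hQ, hQN, hvQ⟩, hvals⟩ := v.exists_monic_new_value_and_values ι hnat hf hinj hpow
    (Valuation.exists_monic_new_value hcount hsurj) hF hFn (hv0 F hF0) hval ((b + 1) * 1)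
    (by omega) hle _ (v.mem_sup_zpowers_iff hH hδH hδb monic_X natDegree_X hvX')
  obtain ⟨-, -, -, -, hexp⟩ := v.exists_approximate_root_of_new_value ι hnat hH hb hδH hδb
    monic_X natDegree_X hvX' hQ hQN hvQ hvals
  let u : ℤᵐ⁰ˣ := Units.mk0 (exp ((m % n : ℕ) : ℤ)) exp_ne_zero
  have hu : u ∈ H ⊔ Subgroup.zpowers δ := by
    have h1 : u * δ⁻¹ ∈ H := by
      rw [hmemH, Units.val_mul, Units.val_inv_eq_inv_val, log_mul u.ne_zero (inv_ne_zero δ.ne_zero),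
        log_inv, Units.val_mk0, Units.val_mk0, log_exp, log_exp]
      refine ⟨-((m / n : ℕ) : ℤ), ?_⟩
      have : (m : ℤ) = n * (m / n : ℕ) + (m % n : ℕ) := by exact_mod_cast (Nat.div_add_mod m n).symm
      linarith
    have := Subgroup.mul_mem_sup h1 (Subgroup.mem_zpowers δ)
    rwa [inv_mul_cancel_right] at this
  obtain ⟨e, he, j, -, hej⟩ := hexp u hu (by
    rw [Units.val_mk0, ← exp_zero, exp_le_exp]; positivity)
  have hve : e.eval₂ (compRingHom f) g ≠ 0 := by
    intro h0
    rw [hv0 e h0, zero_mul] at hej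
    exact u.ne_zero hej.symm
  have hlog := congrArg log hej
  rw [hv1 e hve, log_mul exp_ne_zero (pow_ne_zero _ δ.ne_zero), log_pow, Units.val_mk0,
    Units.val_mk0, log_exp, log_exp, log_exp, nsmul_eq_mul] at hlog
  norm_cast at hlog
  have hmod := Nat.mod_lt m hf
  rcases Nat.eq_zero_or_pos j with rfl | hj
  · have heC : e = C (e.coeff 0) :=
      eq_C_of_natDegree_le_zero (natDegree_le_iff_coeff_eq_zero.2
          fun i hi => (degree_lt_iff_coeff_zero _ 1).1 he i hi)
    rw [heC, eval₂_C, coe_compRingHom_apply, natDegree_comp, zero_mul, add_zero] at hlog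
    refine hndvd ((Nat.dvd_mod_iff (dvd_refl n)).1 ?_)
    rw [← hlog]
    exact dvd_mul_left _ _
  · have : 1 * m ≤ j * m := Nat.mul_le_mul_right _ hj
    omega

theorem exists_eval₂_compRingHom_eq {σ : MvPolynomial (Fin 2) K →ₐ[K] K[X]}
    (hσ : Function.Surjective σ) {i j : Fin 2} (hij : ∀ l, l = i ∨ l = j) (q : K[X]) :
    ∃ p : K[X][X], p.eval₂ (compRingHom (σ (MvPolynomial.X i))) (σ (MvPolynomial.X j)) = q := by
  obtain ⟨r, rfl⟩ := hσ q
  induction r using MvPolynomial.induction_on with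
  | C a =>
    refine ⟨C (C a), ?_⟩
    rw [eval₂_C, coe_compRingHom_apply, C_comp, ← MvPolynomial.algebraMap_eq, AlgHom.commutes]
    rfl
  | add p q hp hq =>
    obtain ⟨p', hp⟩ := hp
    obtain ⟨q', hq⟩ := hq
    exact ⟨p' + q', by rw [eval₂_add, hp, hq, map_add]⟩
  | mul_X p l hp =>
    obtain ⟨p', hp⟩ := hp
    rcases hij l with rfl | rfl
    · exact ⟨p' * C X, by rw [eval₂_mul, hp, eval₂_C, coe_compRingHom_apply, X_comp, map_mul]⟩
    · exact ⟨p' * X, by rw [eval₂_mul, hp, eval₂_X, map_mul]⟩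

end Epimorphism

/-- **The epimorphism theorem (Abhyankar–Moh).**
If `σ : ℂ[X,Y] → ℂ[T]` is a surjective homomorphism of `ℂ`-algebras with `P := σ X` and
`Q := σ Y` both of positive degree, then `deg P` divides `deg Q` or `deg Q` divides
`deg P`. -/
theorem stmt_18 (σ : MvPolynomial (Fin 2) ℂ →ₐ[ℂ] Polynomial ℂ)
    (hσ : Function.Surjective σ)
    (hP : 0 < (σ (MvPolynomial.X 0)).natDegree)
    (hQ : 0 < (σ (MvPolynomial.X 1)).natDegree) :
    (σ (MvPolynomial.X 0)).natDegree ∣ (σ (MvPolynomial.X 1)).natDegree ∨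
      (σ (MvPolynomial.X 1)).natDegree ∣ (σ (MvPolynomial.X 0)).natDegree := by
  rcases lt_trichotomy (σ (MvPolynomial.X 0)).natDegree (σ (MvPolynomial.X 1)).natDegree with
    h | h | h
  · exact Or.inl (natDegree_dvd_of_lt_of_forall_exists_eval₂_eq hP h
      (exists_eval₂_compRingHom_eq hσ (by decide)))
  · exact Or.inl h.dvd
  · exact Or.inr (natDegree_dvd_of_lt_of_forall_exists_eval₂_eq hQ h
      (exists_eval₂_compRingHom_eq hσ (by decide)))
end

section
/- (Embedding line theorem) Let σ : ℂ[X,Y] → ℂ[T] be a surjective homomorphism of ℂ-algebras. Then there exists a ℂ-algebra automorphism τ of ℂ[X,Y] such that the composite σ∘τ sends X to T and Y to 0. -/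
section

open Polynomial

namespace LineEmbedding

section Valuation

variable {K Γ₀ : Type*} [Field K] [LinearOrderedCommGroupWithZero Γ₀]

/-- A monic polynomial is minimal for `w` if its value is smallest among the monic polynomials
of the same degree. -/
def IsMinimal (w : Valuation K[X] Γ₀) (f : K[X]) : Prop :=
  f.Monic ∧ ∀ g : K[X], g.Monic → g.natDegree = f.natDegree → w f ≤ w g

/-- The values of the nonzero polynomials of degree less than `j`. -/
def valuesBelow (w : Valuation K[X] Γ₀) (j : ℕ) : Set Γ₀ :=
  {γ | ∃ A : K[X], A ≠ 0 ∧ A.degree < j ∧ w A = γ}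

/-- The values of the nonzero polynomials of degree less than `j` form a group. -/
structure IsSpecial (w : Valuation K[X] Γ₀) (j : ℕ) : Prop where
  pos : 0 < j
  mul_mem : ∀ γ ∈ valuesBelow w j, ∀ δ ∈ valuesBelow w j, γ * δ ∈ valuesBelow w j
  inv_mem : ∀ γ ∈ valuesBelow w j, γ⁻¹ ∈ valuesBelow w j

/-- Sums of terms `A * f ^ i` with `deg A < deg f`, of degree at most `M` and with
`w A * w f ^ i ≤ N`. -/
noncomputable def adicBall (w : Valuation K[X] Γ₀) (f : K[X]) (N : Γ₀) (M : ℕ) :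
    AddSubmonoid K[X] :=
  AddSubmonoid.closure {Φ | ∃ (A : K[X]) (i : ℕ), A.degree < (f.natDegree : WithBot ℕ) ∧
    A.natDegree + i * f.natDegree ≤ M ∧ w A * w f ^ i ≤ N ∧ Φ = A * f ^ i}

variable {w : Valuation K[X] Γ₀} {f g A B : K[X]} {j : ℕ}

lemma degree_zero_lt (n : ℕ) : (0 : K[X]).degree < (n : WithBot ℕ) := by
  rw [degree_zero]
  exact WithBot.bot_lt_coe _

lemma degree_add_lt {n : WithBot ℕ} (hA : A.degree < n) (hB : B.degree < n) :
    (A + B).degree < n :=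
  (degree_add_le A B).trans_lt (max_lt hA hB)

lemma degree_sub_lt_of_lt {n : WithBot ℕ} (hA : A.degree < n) (hB : B.degree < n) :
    (A - B).degree < n :=
  (degree_sub_le A B).trans_lt (max_lt hA hB)

lemma degree_C_mul_lt {n : WithBot ℕ} (c : K) (hA : A.degree < n) : (C c * A).degree < n := by
  refine lt_of_le_of_lt ?_ hA
  rw [← smul_eq_C_mul]
  exact degree_smul_le c A

lemma natDegree_mul_pow (hf : f.Monic) (hA : A ≠ 0) (l : ℕ) :
    (A * f ^ l).natDegree = A.natDegree + l * f.natDegree := by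
  rw [natDegree_mul hA (pow_ne_zero _ hf.ne_zero), hf.natDegree_pow]

lemma degree_mul_pow_lt (hf : f.Monic) {l m : ℕ} (hA : A.degree < (m : WithBot ℕ)) :
    (A * f ^ l).degree < ((m + l * f.natDegree : ℕ) : WithBot ℕ) := by
  rcases eq_or_ne A 0 with rfl | hA0
  · rw [zero_mul]
    exact degree_zero_lt _
  · rw [← natDegree_lt_iff_degree_lt hA0] at hA
    have : A * f ^ l ≠ 0 := mul_ne_zero hA0 (pow_ne_zero _ hf.ne_zero)
    rw [← natDegree_lt_iff_degree_lt this, natDegree_mul_pow hf hA0]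
    omega

lemma degree_sub_lt_of_monic {n : ℕ} (hf : f.Monic) (hg : g.Monic) (hfn : f.natDegree = n)
    (hgn : g.natDegree = n) : (f - g).degree < (n : WithBot ℕ) := by
  have h1 : f.degree = n := by rw [degree_eq_natDegree hf.ne_zero, hfn]
  have h2 : g.degree = n := by rw [degree_eq_natDegree hg.ne_zero, hgn]
  have := Polynomial.degree_sub_lt_left (h1.trans h2.symm) hf.ne_zero
    (by rw [hf.leadingCoeff, hg.leadingCoeff])
  rwa [h1] at this

lemma map_C_ne_zero {c : K} (hc : c ≠ 0) : w (C c) ≠ 0 := fun h => by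
  have : w (C c * C c⁻¹) = 0 := by rw [map_mul, h, zero_mul]
  rw [← C_mul, mul_inv_cancel₀ hc, C_1, map_one] at this
  exact one_ne_zero this

lemma map_C_inv (c : K) : w (C c⁻¹) = (w (C c))⁻¹ := by
  rcases eq_or_ne c 0 with rfl | hc
  · simp
  · refine eq_inv_of_mul_eq_one_left ?_
    rw [← map_mul, ← C_mul, inv_mul_cancel₀ hc, C_1, map_one]

namespace IsMinimal

lemma le_map_C_mul_add (hf : IsMinimal w f) (c : K) {h : K[X]} (hh : h.degree < f.degree) :
    w (C c) * w f ≤ w (C c * f + h) := by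
  rcases eq_or_ne c 0 with rfl | hc
  · simp
  · have h1 : C c * f + h = C c * (f + C c⁻¹ * h) := by
      rw [mul_add, ← mul_assoc, ← C_mul, mul_inv_cancel₀ hc, C_1, one_mul]
    have hlt := degree_C_mul_lt c⁻¹ hh
    rw [h1, map_mul]
    refine mul_le_mul_right (hf.2 _ (hf.1.add_of_left hlt) ?_) _
    exact natDegree_eq_of_degree_eq (degree_add_eq_left_of_degree_lt hlt)

lemma le_map_C_mul_add' (hf : IsMinimal w f) (c : K) {h : K[X]} (hh : h.degree < f.degree) :
    w h ≤ w (C c * f + h) := by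
  have h1 := hf.le_map_C_mul_add c hh
  have h2 : h = (C c * f + h) - C c * f := by ring
  conv_lhs => rw [h2]
  exact w.map_sub_le le_rfl (by rwa [map_mul])

lemma ne_of_degree_lt (hres : ∀ a b : K[X], w a ≠ 0 → w a = w b → ∃ c : K, w (a - C c * b) < w a)
    (hf : IsMinimal w f) (hf0 : w f ≠ 0) {h : K[X]} (hh : h.degree < f.degree) : w f ≠ w h := by
  intro he
  obtain ⟨c, hc⟩ := hres f h hf0 he
  have := hf.le_map_C_mul_add 1 (h := -(C c * h)) (by
    rw [degree_neg]; exact degree_C_mul_lt c hh)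
  rw [C_1, one_mul, map_one, one_mul, ← sub_eq_add_neg] at this
  exact absurd hc (not_lt.2 this)

end IsMinimal

lemma exists_eq_mul_pow_add (hf : f.Monic) (hfj : f.natDegree = j) {l : ℕ} {Φ : K[X]}
    (hΦ : Φ.degree < (((l + 1) * j : ℕ) : WithBot ℕ)) :
    ∃ A B : K[X], Φ = A * f ^ l + B ∧ A.degree < (j : WithBot ℕ) ∧
      B.degree < ((l * j : ℕ) : WithBot ℕ) ∧ (A ≠ 0 → A.natDegree + l * j ≤ Φ.natDegree) ∧
      B.natDegree ≤ Φ.natDegree := by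
  have hm : (f ^ l).Monic := hf.pow l
  have hmd : (f ^ l).natDegree = l * j := by rw [hf.natDegree_pow, hfj]
  have hA : Φ /ₘ f ^ l ≠ 0 → (Φ /ₘ f ^ l).natDegree + l * j = Φ.natDegree := by
    intro h
    rw [Ne, divByMonic_eq_zero_iff hm, not_lt] at h
    have := natDegree_le_natDegree h
    rw [natDegree_divByMonic _ hm, hmd]
    omega
  refine ⟨Φ /ₘ f ^ l, Φ %ₘ f ^ l, ?_, ?_, ?_, fun h => (hA h).le, natDegree_modByMonic_le_left⟩
  · rw [mul_comm, add_comm, modByMonic_add_div]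
  · rcases eq_or_ne (Φ /ₘ f ^ l) 0 with h | h
    · rw [h]
      exact degree_zero_lt _
    · have hΦ0 : Φ ≠ 0 := by rintro rfl; simp at h
      rw [← natDegree_lt_iff_degree_lt hΦ0] at hΦ
      rw [← natDegree_lt_iff_degree_lt h]
      have := hA h
      rw [add_mul] at hΦ
      omega
  · have := degree_modByMonic_lt Φ hm
    rwa [degree_eq_natDegree hm.ne_zero, hmd] at this

/-- The hypotheses on `f` under which values can be read off the first `q` terms of `f`-adic
expansions. -/
structure IsIndependent (w : Valuation K[X] Γ₀) (f : K[X]) (j q : ℕ) : Prop where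
  monic : f.Monic
  natDegree_eq : f.natDegree = j
  special : IsSpecial w j
  map_ne_zero : w f ≠ 0
  map_ne_zero_of_degree_lt : ∀ A : K[X], A ≠ 0 → A.degree < (j : WithBot ℕ) → w A ≠ 0
  pow_notMem : ∀ k, 0 < k → k < q → w f ^ k ∉ valuesBelow w j

namespace IsIndependent

variable {q : ℕ}

lemma exists_map_eq_and_map_mul_pow_add (h : IsIndependent w f j q) {l : ℕ} (hl : l ≤ q) :
    (∀ Φ : K[X], Φ ≠ 0 → Φ.degree < ((l * j : ℕ) : WithBot ℕ) →
      ∃ k < l, ∃ γ ∈ valuesBelow w j, w Φ = γ * w f ^ k) ∧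
    (l < q → ∀ A B : K[X], A.degree < (j : WithBot ℕ) →
      B.degree < ((l * j : ℕ) : WithBot ℕ) →
      w (A * f ^ l + B) = max (w A * w f ^ l) (w B)) := by
  induction l with
  | zero =>
    refine ⟨fun Φ h0 hd => ?_, fun _ A B _ hB => ?_⟩
    · rw [zero_mul, Nat.cast_zero] at hd
      exact absurd (Nat.WithBot.lt_zero_iff.1 hd) (by simpa using h0)
    · rw [zero_mul, Nat.cast_zero, Nat.WithBot.lt_zero_iff, degree_eq_bot] at hB
      simp [hB]
  | succ l ih =>
    obtain ⟨ih1, ih2⟩ := ih (by omega)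
    have key : ∀ Φ : K[X], Φ ≠ 0 → Φ.degree < (((l + 1) * j : ℕ) : WithBot ℕ) →
        ∃ k < l + 1, ∃ γ ∈ valuesBelow w j, w Φ = γ * w f ^ k := by
      intro Φ h0 hd
      obtain ⟨A, B, rfl, hA, hB, -, -⟩ := exists_eq_mul_pow_add h.monic h.natDegree_eq hd
      rw [ih2 (by omega) A B hA hB]
      rcases eq_or_ne A 0 with rfl | hA0
      · rcases eq_or_ne B 0 with rfl | hB0
        · simp at h0
        · obtain ⟨k, hk, γ, hγ, he⟩ := ih1 B hB0 hB
          exact ⟨k, by omega, γ, hγ, by simpa using he⟩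
      · rcases le_total (w A * w f ^ l) (w B) with hle | hle
        · rcases eq_or_ne B 0 with rfl | hB0
          · exact ⟨l, by omega, w A, ⟨A, hA0, hA, rfl⟩, by simp⟩
          · obtain ⟨k, hk, γ, hγ, he⟩ := ih1 B hB0 hB
            exact ⟨k, by omega, γ, hγ, by rw [max_eq_right hle, he]⟩
        · exact ⟨l, by omega, w A, ⟨A, hA0, hA, rfl⟩, max_eq_left hle⟩
    refine ⟨key, fun hlq A B hA hB => ?_⟩
    rcases eq_or_ne A 0 with rfl | hA0
    · simp
    rcases eq_or_ne B 0 with rfl | hB0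
    · simp
    obtain ⟨k, hk, γ, hγ, he⟩ := key B hB0 hB
    rw [Valuation.map_add_of_distinct_val, map_mul, map_pow]
    rw [map_mul, map_pow, he]
    intro heq
    refine h.pow_notMem (l + 1 - k) (by omega) (by omega) ?_
    have hwA := h.map_ne_zero_of_degree_lt A hA0 hA
    have : w f ^ (l + 1 - k) = γ * (w A)⁻¹ := by
      rw [eq_mul_inv_iff_mul_eq₀ hwA]
      refine mul_right_cancel₀ (pow_ne_zero k h.map_ne_zero) ?_
      rw [← heq, mul_comm _ (w A), mul_assoc, ← pow_add]
      congr 2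
      omega
    rw [this]
    exact h.special.mul_mem _ hγ _ (h.special.inv_mem _ ⟨A, hA0, hA, rfl⟩)

lemma map_mul_pow_add (h : IsIndependent w f j q) {l : ℕ} (hl : l < q)
    (hA : A.degree < (j : WithBot ℕ)) (hB : B.degree < ((l * j : ℕ) : WithBot ℕ)) :
    w (A * f ^ l + B) = max (w A * w f ^ l) (w B) :=
  (h.exists_map_eq_and_map_mul_pow_add hl.le).2 hl A B hA hB

lemma exists_map_eq (h : IsIndependent w f j q) {Φ : K[X]} (h0 : Φ ≠ 0)
    (hd : Φ.degree < ((q * j : ℕ) : WithBot ℕ)) :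
    ∃ k < q, ∃ γ ∈ valuesBelow w j, w Φ = γ * w f ^ k :=
  (h.exists_map_eq_and_map_mul_pow_add le_rfl).1 Φ h0 hd

lemma map_ne_zero' (h : IsIndependent w f j q) {Φ : K[X]} (h0 : Φ ≠ 0)
    (hd : Φ.degree < ((q * j : ℕ) : WithBot ℕ)) : w Φ ≠ 0 := by
  obtain ⟨k, -, γ, ⟨A, hA0, hA, rfl⟩, he⟩ := h.exists_map_eq h0 hd
  rw [he]
  exact mul_ne_zero (h.map_ne_zero_of_degree_lt A hA0 hA) (pow_ne_zero _ h.map_ne_zero)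

end IsIndependent

lemma adicBall_mono {N N' : Γ₀} {M M' : ℕ} (hN : N ≤ N') (hM : M ≤ M') :
    adicBall w f N M ≤ adicBall w f N' M' := by
  refine AddSubmonoid.closure_mono ?_
  rintro _ ⟨A, i, h1, h2, h3, rfl⟩
  exact ⟨A, i, h1, h2.trans hM, h3.trans hN, rfl⟩

lemma mul_pow_mem_adicBall {N : Γ₀} {M : ℕ} {Φ : K[X]} (hΦ : Φ ∈ adicBall w f N M) (k : ℕ) :
    Φ * f ^ k ∈ adicBall w f (N * w f ^ k) (M + k * f.natDegree) := by
  induction hΦ using AddSubmonoid.closure_induction with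
  | mem x hx =>
    obtain ⟨A, i, h1, h2, h3, rfl⟩ := hx
    refine AddSubmonoid.subset_closure ⟨A, i + k, h1, ?_, ?_, ?_⟩
    · rw [add_mul]; omega
    · rw [pow_add, ← mul_assoc]; exact mul_le_mul_left h3 _
    · rw [pow_add, mul_assoc]
  | zero => rw [zero_mul]; exact zero_mem _
  | add x y _ _ hx hy => rw [add_mul]; exact add_mem hx hy

namespace IsIndependent

variable {q : ℕ}

lemma mem_adicBall (h : IsIndependent w f j q) {l : ℕ} (hl : l ≤ q) {Φ : K[X]}
    (hd : Φ.degree < ((l * j : ℕ) : WithBot ℕ)) {M : ℕ} (hM : Φ.natDegree ≤ M) :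
    Φ ∈ adicBall w f (w Φ) M := by
  induction l generalizing Φ with
  | zero =>
    rw [zero_mul, Nat.cast_zero, Nat.WithBot.lt_zero_iff, degree_eq_bot] at hd
    rw [hd]
    exact zero_mem _
  | succ l ih =>
    obtain ⟨A, B, rfl, hA, hB, hAd, hBd⟩ := exists_eq_mul_pow_add h.monic h.natDegree_eq hd
    have hw := h.map_mul_pow_add (by omega) hA hB
    refine add_mem ?_ ?_
    · rcases eq_or_ne A 0 with rfl | hA0
      · rw [zero_mul]; exact zero_mem _
      · refine AddSubmonoid.subset_closure ⟨A, l, ?_, ?_, ?_, rfl⟩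
        · rwa [h.natDegree_eq]
        · rw [h.natDegree_eq]; exact (hAd hA0).trans hM
        · rw [hw]; exact le_max_left _ _
    · refine adicBall_mono ?_ le_rfl (ih (by omega) hB (hBd.trans hM))
      rw [hw]; exact le_max_right _ _

lemma mul_mem_adicBall (h : IsIndependent w f j q) (hq : 2 ≤ q) {N N' : Γ₀} {M M' : ℕ}
    {Φ Ψ : K[X]} (hΦ : Φ ∈ adicBall w f N M) (hΨ : Ψ ∈ adicBall w f N' M') :
    Φ * Ψ ∈ adicBall w f (N * N') (M + M') := by
  induction hΦ using AddSubmonoid.closure_induction with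
  | zero => rw [zero_mul]; exact zero_mem _
  | add x y _ _ hx hy => rw [add_mul]; exact add_mem hx hy
  | mem x hx =>
    induction hΨ using AddSubmonoid.closure_induction with
    | zero => rw [mul_zero]; exact zero_mem _
    | add x y _ _ hx hy => rw [mul_add]; exact add_mem hx hy
    | mem y hy =>
      obtain ⟨A, i, h1, h2, h3, rfl⟩ := hx
      obtain ⟨B, k, h1', h2', h3', rfl⟩ := hy
      have hAB : (A * B).degree < ((2 * j : ℕ) : WithBot ℕ) := by
        rcases eq_or_ne A 0 with rfl | hA0
        · rw [zero_mul]; exact degree_zero_lt _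
        rcases eq_or_ne B 0 with rfl | hB0
        · rw [mul_zero]; exact degree_zero_lt _
        rw [← natDegree_lt_iff_degree_lt hA0, h.natDegree_eq] at h1
        rw [← natDegree_lt_iff_degree_lt hB0, h.natDegree_eq] at h1'
        rw [← natDegree_lt_iff_degree_lt (mul_ne_zero hA0 hB0), natDegree_mul hA0 hB0]
        omega
      have := mul_pow_mem_adicBall (h.mem_adicBall hq hAB natDegree_mul_le) (i + k)
      have e : A * f ^ i * (B * f ^ k) = A * B * f ^ (i + k) := by ring
      rw [e]
      refine adicBall_mono ?_ ?_ this
      · rw [map_mul]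
        calc w A * w B * w f ^ (i + k) = (w A * w f ^ i) * (w B * w f ^ k) := by
              rw [pow_add, mul_mul_mul_comm]
          _ ≤ N * N' := mul_le_mul' h3 h3'
      · rw [add_mul]; omega

lemma pow_mem_adicBall (h : IsIndependent w f j q) (hq : 2 ≤ q) {N : Γ₀} {M : ℕ}
    {Φ : K[X]} (hΦ : Φ ∈ adicBall w f N M) (k : ℕ) :
    Φ ^ k ∈ adicBall w f (N ^ k) (k * M) := by
  induction k with
  | zero =>
    have h1 : (1 : K[X]).degree < ((1 * j : ℕ) : WithBot ℕ) := by
      rw [degree_one, one_mul]; exact_mod_cast h.special.pos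
    have := h.mem_adicBall (l := 1) (by omega) h1 (M := 0) (by simp)
    simpa using this
  | succ k ih =>
    rw [pow_succ, pow_succ, add_mul, one_mul]
    exact h.mul_mem_adicBall hq ih hΦ

lemma mem_valuesBelow_iff (h : IsIndependent w f j q) {γ : Γ₀} :
    γ ∈ valuesBelow w (q * j) ↔ ∃ k < q, ∃ δ ∈ valuesBelow w j, γ = δ * w f ^ k := by
  constructor
  · rintro ⟨A, hA0, hA, rfl⟩
    exact h.exists_map_eq hA0 hA
  · rintro ⟨k, hk, _, ⟨A, hA0, hA, rfl⟩, rfl⟩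
    refine ⟨A * f ^ k, mul_ne_zero hA0 (pow_ne_zero _ h.monic.ne_zero), ?_, by simp⟩
    refine (degree_mul_pow_lt h.monic hA).trans_le ?_
    rw [h.natDegree_eq]
    norm_cast
    calc j + k * j = (k + 1) * j := by ring
      _ ≤ q * j := Nat.mul_le_mul_right _ hk

lemma isSpecial_mul (h : IsIndependent w f j q) (hq : 0 < q) (hmem : w f ^ q ∈ valuesBelow w j) :
    IsSpecial w (q * j) where
  pos := Nat.mul_pos hq h.special.pos
  mul_mem γ hγ δ hδ := by
    rw [h.mem_valuesBelow_iff] at hγ hδ ⊢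
    obtain ⟨k, hk, γ, hγ, rfl⟩ := hγ
    obtain ⟨l, hl, δ, hδ, rfl⟩ := hδ
    rw [mul_mul_mul_comm, ← pow_add]
    rcases lt_or_ge (k + l) q with hkl | hkl
    · exact ⟨k + l, hkl, _, h.special.mul_mem _ hγ _ hδ, rfl⟩
    · refine ⟨k + l - q, by omega, γ * δ * w f ^ q,
        h.special.mul_mem _ (h.special.mul_mem _ hγ _ hδ) _ hmem, ?_⟩
      rw [mul_assoc (γ * δ), ← pow_add, Nat.add_sub_cancel' hkl]
  inv_mem γ hγ := by
    rw [h.mem_valuesBelow_iff] at hγ ⊢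
    obtain ⟨k, hk, γ, hγ, rfl⟩ := hγ
    rcases Nat.eq_zero_or_pos k with rfl | hk0
    · exact ⟨0, hq, γ⁻¹, h.special.inv_mem _ hγ, by simp⟩
    · refine ⟨q - k, by omega, γ⁻¹ * (w f ^ q)⁻¹,
        h.special.mul_mem _ (h.special.inv_mem _ hγ) _ (h.special.inv_mem _ hmem), ?_⟩
      rw [pow_sub₀ _ h.map_ne_zero hk.le, mul_inv, mul_assoc,
        inv_mul_cancel_left₀ (pow_ne_zero _ h.map_ne_zero)]

/-- A product `g * f ^ l` of minimal polynomials is minimal. -/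
lemma isMinimal_mul_pow (h : IsIndependent w f j q) {l : ℕ} (hl : l < q) (hg : IsMinimal w g)
    (hgj : g.natDegree < j) : IsMinimal w (g * f ^ l) := by
  refine ⟨hg.1.mul (h.monic.pow l), fun Φ hΦ hd => ?_⟩
  rw [natDegree_mul_pow h.monic hg.1.ne_zero, h.natDegree_eq] at hd
  have hdeg : Φ.degree < (((l + 1) * j : ℕ) : WithBot ℕ) := by
    rw [← natDegree_lt_iff_degree_lt hΦ.ne_zero, hd, add_mul]
    omega
  obtain ⟨A, B, rfl, hA, hB, -, -⟩ := exists_eq_mul_pow_add h.monic h.natDegree_eq hdeg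
  have hlt : B.degree < (A * f ^ l).degree := by
    by_contra hcon
    rw [not_lt] at hcon
    have h1 := (degree_add_le (A * f ^ l) B).trans (max_le hcon le_rfl)
    have h2 : (A * f ^ l + B).degree < ((l * j : ℕ) : WithBot ℕ) := h1.trans_lt hB
    rw [← natDegree_lt_iff_degree_lt hΦ.ne_zero] at h2
    omega
  rw [h.map_mul_pow_add hl hA hB, map_mul, map_pow]
  refine le_max_of_le_left (mul_le_mul_left (hg.2 A ?_ ?_) _)
  · have := hΦ
    rw [Monic, leadingCoeff_add_of_degree_lt' hlt, leadingCoeff_mul,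
      (h.monic.pow l).leadingCoeff, mul_one] at this
    exact this
  · have hA0 : A ≠ 0 := by rintro rfl; simp at hlt
    rw [natDegree_eq_of_degree_eq (degree_add_eq_left_of_degree_lt hlt),
      natDegree_mul_pow h.monic hA0, h.natDegree_eq] at hd
    omega

/-- A monic polynomial of degree `q * j` whose value is at most that of `f ^ q` lies in the
`f`-adic ball of that radius. -/
lemma mem_adicBall_of_monic (h : IsIndependent w f j q) (hg : g.Monic)
    (hgd : g.natDegree = q * j) (hle : w g ≤ w f ^ q) : g ∈ adicBall w f (w f ^ q) (q * j) := by
  have hfq : (f ^ q).natDegree = q * j := by rw [h.monic.natDegree_pow, h.natDegree_eq]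
  have hlt := degree_sub_lt_of_monic hg (h.monic.pow q) hgd hfq
  have h1 : f ^ q ∈ adicBall w f (w f ^ q) (q * j) := by
    refine AddSubmonoid.subset_closure ⟨1, q, ?_, ?_, by simp, by simp⟩
    · rw [degree_one, h.natDegree_eq]; exact_mod_cast h.special.pos
    · simp [h.natDegree_eq]
  have h2 : g - f ^ q ∈ adicBall w f (w f ^ q) (q * j) := by
    refine adicBall_mono ?_ le_rfl (h.mem_adicBall le_rfl hlt (M := q * j) ?_)
    · exact w.map_sub_le hle (by rw [map_pow])
    · refine (natDegree_sub_le _ _).trans ?_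
      rw [hgd, hfq, max_self]
  have := add_mem h1 h2
  rwa [add_sub_cancel] at this

lemma adicBall_le (h : IsIndependent w f j q) (hq : 2 ≤ q) (hg : g.Monic)
    (hgd : g.natDegree = q * j) (hg0 : w g ≠ 0) (hle : w g ≤ w f ^ q) (d : ℕ) :
    adicBall w g (w g ^ d) (d * (q * j)) ≤ adicBall w f (w f ^ (d * q)) (d * (q * j)) := by
  have hmem := h.mem_adicBall_of_monic hg hgd hle
  refine (AddSubmonoid.closure_le).2 ?_
  rintro _ ⟨A, i, h1, h2, h3, rfl⟩
  rw [hgd] at h1 h2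
  have hqj : 0 < q * j := Nat.mul_pos (by omega) h.special.pos
  have hid : i ≤ d := by
    by_contra hcon
    have : (d + 1) * (q * j) ≤ i * (q * j) := Nat.mul_le_mul_right _ (by omega)
    rw [add_mul] at this
    omega
  have hA := h.mem_adicBall le_rfl h1 (M := A.natDegree) le_rfl
  refine adicBall_mono ?_ h2 (h.mul_mem_adicBall hq hA (h.pow_mem_adicBall hq hmem i))
  have hwA : w A ≤ w g ^ (d - i) := by
    refine le_of_mul_le_mul_right ?_ (zero_lt_iff.2 (pow_ne_zero i hg0))
    rwa [← pow_add, Nat.sub_add_cancel hid]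
  calc w A * (w f ^ q) ^ i ≤ (w f ^ q) ^ (d - i) * (w f ^ q) ^ i :=
        mul_le_mul_left (hwA.trans (pow_le_pow_left' hle _)) _
    _ = w f ^ (d * q) := by
        rw [← pow_add, Nat.sub_add_cancel hid, ← pow_mul, mul_comm]

end IsIndependent

/-- The first two coefficients of the `f`-adic expansion. -/
lemma exists_degree_sub_lt_of_mem_adicBall (hf : f.Monic) (hfj : f.natDegree = j) (hj : 0 < j)
    (hf0 : w f ≠ 0) {d : ℕ} {Φ : K[X]} (hΦ : Φ ∈ adicBall w f (w f ^ (d + 2)) ((d + 2) * j)) :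
    ∃ (c : K) (a : K[X]), a.degree < (j : WithBot ℕ) ∧ w a ≤ w f ∧
      (Φ - C c * f ^ (d + 2) - a * f ^ (d + 1)).degree < (((d + 1) * j : ℕ) : WithBot ℕ) := by
  induction hΦ using AddSubmonoid.closure_induction with
  | zero => exact ⟨0, 0, degree_zero_lt _, by simp, by
    rw [C_0, zero_mul, zero_mul, sub_zero, sub_zero]
    exact degree_zero_lt _⟩
  | add x y _ _ hx hy =>
    obtain ⟨c, a, h1, h2, h3⟩ := hx
    obtain ⟨c', a', h1', h2', h3'⟩ := hy
    refine ⟨c + c', a + a', degree_add_lt h1 h1', w.map_add_le h2 h2', ?_⟩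
    have : x + y - C (c + c') * f ^ (d + 2) - (a + a') * f ^ (d + 1) =
        (x - C c * f ^ (d + 2) - a * f ^ (d + 1)) +
          (y - C c' * f ^ (d + 2) - a' * f ^ (d + 1)) := by
      rw [C_add]; ring
    rw [this]
    exact degree_add_lt h3 h3'
  | mem x hx =>
    obtain ⟨A, i, h1, h2, h3, rfl⟩ := hx
    rw [hfj] at h1 h2
    have hi : i ≤ d + 2 := by
      by_contra hcon
      have : (d + 2 + 1) * j ≤ i * j := Nat.mul_le_mul_right _ (by omega)
      rw [add_mul (d + 2)] at this
      omega
    rcases eq_or_lt_of_le hi with rfl | hi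
    · have hA : A = C (A.coeff 0) := eq_C_of_natDegree_eq_zero (by omega)
      refine ⟨A.coeff 0, 0, degree_zero_lt _, by simp, ?_⟩
      rw [← hA, sub_self, zero_mul, sub_zero]
      exact degree_zero_lt _
    rcases eq_or_lt_of_le (Nat.lt_succ_iff.1 hi) with rfl | hi
    · refine ⟨0, A, h1, ?_, ?_⟩
      · refine le_of_mul_le_mul_right ?_ (zero_lt_iff.2 (pow_ne_zero (d + 1) hf0))
        rwa [← pow_succ']
      · rw [C_0, zero_mul, sub_zero, sub_self]
        exact degree_zero_lt _
    · refine ⟨0, 0, by simp, by simp, ?_⟩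
      rw [C_0, zero_mul, zero_mul, sub_zero, sub_zero]
      refine (degree_mul_pow_lt hf h1).trans_le ?_
      rw [hfj]
      norm_cast
      calc j + i * j = (i + 1) * j := by ring
        _ ≤ (d + 1) * j := Nat.mul_le_mul_right _ (by omega)

lemma exists_add_pow_eq {u v : K[X]} (hu : u.natDegree ≤ j) (hv : v.natDegree ≤ j) (d : ℕ) :
    ∃ s : K[X], s.natDegree ≤ d * j ∧ (u + v) ^ (d + 1) = u ^ (d + 1) + v * s := by
  induction d with
  | zero => exact ⟨1, by simp, by ring⟩
  | succ d ih =>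
    obtain ⟨s, hs, he⟩ := ih
    refine ⟨u ^ (d + 1) + (u + v) * s, ?_, by rw [pow_succ, he]; ring⟩
    refine natDegree_add_le_of_degree_le (natDegree_pow_le_of_le _ hu) ?_
    rw [add_mul d 1 j, one_mul, add_comm (d * j)]
    exact natDegree_mul_le_of_le (natDegree_add_le_of_degree_le hu hv) hs

lemma exists_add_pow_eq' {u v : K[X]} (hu : u.natDegree ≤ j) (hv : v.natDegree ≤ j) (d : ℕ) :
    ∃ s : K[X], s.natDegree ≤ d * j ∧
      (u + v) ^ (d + 2) = u ^ (d + 2) + ((d + 2 : ℕ) : K[X]) * v * u ^ (d + 1) + v ^ 2 * s := by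
  induction d with
  | zero => exact ⟨1, by simp, by push_cast; ring⟩
  | succ d ih =>
    obtain ⟨s, hs, he⟩ := ih
    refine ⟨((d + 2 : ℕ) : K[X]) * u ^ (d + 1) + (u + v) * s, ?_, ?_⟩
    · refine natDegree_add_le_of_degree_le ?_ ?_
      · rw [← C_eq_natCast]
        exact (natDegree_C_mul_le _ _).trans (natDegree_pow_le_of_le _ hu)
      · rw [add_mul d 1 j, one_mul, add_comm (d * j)]
        exact natDegree_mul_le_of_le (natDegree_add_le_of_degree_le hu hv) hs
    · rw [pow_succ, he]; push_cast; ring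

lemma degree_lt_of_natDegree_lt {m : ℕ} (h : A.natDegree < m) : A.degree < (m : WithBot ℕ) :=
  degree_le_natDegree.trans_lt (by exact_mod_cast h)

section Integral

variable {R : Type*} [CommRing R] {φ : R →+* K}

lemma exists_degree_sub_lt_of_mul_eq (hφ : Function.Injective φ) {Φ U Ψ θ : K[X]} {m i : ℕ}
    (hU : U.Monic) (hUm : U.natDegree = m) (hUφ : U ∈ (mapRingHom φ).range)
    (hΨ : Ψ ∈ (mapRingHom φ).range) (hθ : θ.degree < ((m + i : ℕ) : WithBot ℕ))
    (h : Φ * U = Ψ + θ) : ∃ Q ∈ (mapRingHom φ).range, (Φ - Q).degree < (i : WithBot ℕ) := by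
  obtain ⟨U, rfl⟩ := hUφ
  obtain ⟨Ψ, rfl⟩ := hΨ
  rw [coe_mapRingHom] at *
  have hU' : U.Monic := (hφ.monic_map_iff).2 hU
  refine ⟨(Ψ /ₘ U).map φ, ⟨_, rfl⟩, ?_⟩
  have h1 : Ψ.map φ = Ψ.map φ %ₘ U.map φ + U.map φ * (Ψ /ₘ U).map φ := by
    rw [map_divByMonic φ hU', modByMonic_add_div]
  have h2 : (Φ - (Ψ /ₘ U).map φ) * U.map φ = Ψ.map φ %ₘ U.map φ + θ := by
    rw [sub_mul, h]
    linear_combination h1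
  rcases eq_or_ne (Φ - (Ψ /ₘ U).map φ) 0 with h0 | h0
  · rw [h0]; exact degree_zero_lt _
  have h3 : ((Φ - (Ψ /ₘ U).map φ) * U.map φ).degree < ((m + i : ℕ) : WithBot ℕ) := by
    rw [h2]
    refine degree_add_lt ?_ hθ
    refine (degree_modByMonic_lt _ hU).trans_le ?_
    rw [degree_eq_natDegree hU.ne_zero, hUm]
    exact_mod_cast Nat.le_add_right m i
  rw [← natDegree_lt_iff_degree_lt (mul_ne_zero h0 hU.ne_zero), natDegree_mul h0 hU.ne_zero,
    hUm] at h3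
  rw [← natDegree_lt_iff_degree_lt h0]
  omega

/-- There is an integral minimal polynomial of every degree less than `j`. -/
def HasIntegralMinimals (w : Valuation K[X] Γ₀) (φ : R →+* K) (j : ℕ) : Prop :=
  ∀ k < j, ∃ f ∈ (mapRingHom φ).range, IsMinimal w f ∧ f.natDegree = k

lemma coeff_mem_range {Q : K[X]} (hQ : Q ∈ (mapRingHom φ).range) (k : ℕ) :
    ∃ r, φ r = Q.coeff k := by
  obtain ⟨Q, rfl⟩ := hQ
  exact ⟨Q.coeff k, by simp⟩

lemma C_mem_range (r : R) : C (φ r) ∈ (mapRingHom φ).range := ⟨C r, by simp⟩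

lemma degree_sub_C_coeff_mul_lt {k : ℕ} {Q : K[X]} (hQ : Q.degree < ((k + 1 : ℕ) : WithBot ℕ))
    (hf : f.Monic) (hfk : f.natDegree = k) : (Q - C (Q.coeff k) * f).degree < (k : WithBot ℕ) := by
  rw [degree_lt_iff_coeff_zero] at hQ ⊢
  intro m hm
  rcases eq_or_lt_of_le hm with rfl | hm
  · have : f.coeff k = 1 := by rw [← hfk]; exact hf
    simp [this]
  · have hfm : f.coeff m = 0 := coeff_eq_zero_of_natDegree_lt (by omega)
    rw [coeff_sub, coeff_C_mul, hQ m (by exact_mod_cast hm), hfm, mul_zero, sub_zero]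

lemma le_map_add_of_mem_range (hone : ∀ r, φ r ≠ 0 → 1 ≤ w (C (φ r)))
    (hint : HasIntegralMinimals w φ j) (hf : IsMinimal w f) {i : ℕ} (hfi : f.natDegree = i)
    {ρ : K} (hρ : w (C ρ) < 1) {Q θ : K[X]} (hQ : Q ∈ (mapRingHom φ).range)
    (hQj : Q.degree < (j : WithBot ℕ)) (hθ : θ.degree < (i : WithBot ℕ)) :
    w (C ρ) * w f ≤ w (Q + C ρ * f + θ) := by
  have hfd : f.degree = i := by rw [degree_eq_natDegree hf.1.ne_zero, hfi]
  suffices H : ∀ m ≤ j, ∀ Q ∈ (mapRingHom φ).range, Q.degree < (m : WithBot ℕ) →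
      w (C ρ) * w f ≤ w (Q + C ρ * f + θ) from H j le_rfl Q hQ hQj
  intro m
  induction m with
  | zero =>
    intro _ Q _ hQ
    rw [Nat.cast_zero, Nat.WithBot.lt_zero_iff, degree_eq_bot] at hQ
    rw [hQ, zero_add]
    exact hf.le_map_C_mul_add ρ (by rwa [hfd])
  | succ m ih =>
    intro hm Q hQ hQm
    obtain ⟨r, hr⟩ := coeff_mem_range hQ m
    rcases lt_trichotomy m i with hmi | rfl | hmi
    · have e : Q + C ρ * f + θ = C ρ * f + (Q + θ) := by ring
      rw [e]
      refine hf.le_map_C_mul_add ρ ?_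
      rw [hfd]
      exact degree_add_lt (hQm.trans_le (by exact_mod_cast hmi)) hθ
    · have e : Q + C ρ * f + θ = C (Q.coeff m + ρ) * f + ((Q - C (Q.coeff m) * f) + θ) := by
        rw [C_add]; ring
      rw [e]
      refine le_trans ?_ (hf.le_map_C_mul_add _ ?_)
      · refine mul_le_mul_left ?_ _
        rcases eq_or_ne (φ r) 0 with h0 | h0
        · rw [← hr, h0, zero_add]
        · rw [← hr, C_add, Valuation.map_add_eq_of_lt_left _ (hρ.trans_le (hone r h0))]
          exact hρ.le.trans (hone r h0)
      · rw [hfd]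
        exact degree_add_lt (degree_sub_C_coeff_mul_lt hQm hf.1 hfi) hθ
    · obtain ⟨g, hgφ, hg, hgm⟩ := hint m (by omega)
      have hgd : g.degree = m := by rw [degree_eq_natDegree hg.1.ne_zero, hgm]
      have hlt := degree_sub_C_coeff_mul_lt hQm hg.1 hgm
      refine (ih (by omega) (Q - C (Q.coeff m) * g) ?_ hlt).trans ?_
      · refine sub_mem hQ (mul_mem ?_ hgφ)
        rw [← hr]
        exact C_mem_range r
      · have e : Q + C ρ * f + θ =
            C (Q.coeff m) * g + ((Q - C (Q.coeff m) * g) + C ρ * f + θ) := by ring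
        rw [e]
        refine hg.le_map_C_mul_add' _ ?_
        have him : (i : WithBot ℕ) < m := by exact_mod_cast hmi
        rw [hgd]
        refine degree_add_lt (degree_add_lt hlt (degree_C_mul_lt _ ?_)) (hθ.trans him)
        rwa [hfd]

lemma exists_isMinimal_mem_range
    (hone : ∀ r, φ r ≠ 0 → 1 ≤ w (C (φ r))) (hφ : Function.Injective φ)
    (hfrac : ∀ b : K, ∃ r, w (C (b - φ r)) < 1)
    (hcast : ∀ d : ℕ, d ≠ 0 → w (C (d : K)) = 1)
    (hint : HasIntegralMinimals w φ j) {P : K[X]} (hP : P ∈ (mapRingHom φ).range) {d : ℕ}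
    (hexp : ∀ f, IsMinimal w f → f.natDegree = j → w f ≠ 0 ∧
      ∃ a : K[X], a.degree < (j : WithBot ℕ) ∧ w a ≤ w f ∧
        (P - f ^ (d + 2) - a * f ^ (d + 1)).degree < (((d + 1) * j : ℕ) : WithBot ℕ))
    (hmin : ∃ f, IsMinimal w f ∧ f.natDegree = j) :
    ∃ f ∈ (mapRingHom φ).range, IsMinimal w f ∧ f.natDegree = j := by
  suffices H : ∀ m ≤ j, ∃ f u θ : K[X], IsMinimal w f ∧ f.natDegree = j ∧
      u ∈ (mapRingHom φ).range ∧ θ.degree < ((j - m : ℕ) : WithBot ℕ) ∧ f = u + θ by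
    obtain ⟨f, u, θ, hf, hfj, hu, hθ, rfl⟩ := H j le_rfl
    rw [Nat.sub_self, Nat.cast_zero, Nat.WithBot.lt_zero_iff, degree_eq_bot] at hθ
    rw [hθ, add_zero] at hf hfj
    exact ⟨u, hu, hf, hfj⟩
  intro m
  induction m with
  | zero =>
    intro _
    obtain ⟨f, hf, hfj⟩ := hmin
    have hX : (X : K[X]) ∈ (mapRingHom φ).range := ⟨X, by simp⟩
    refine ⟨f, X ^ j, f - X ^ j, hf, hfj, pow_mem hX _, ?_, by ring⟩
    exact degree_sub_lt_of_monic hf.1 (monic_X_pow j) hfj (natDegree_X_pow j)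
  | succ m ih =>
    intro hm
    obtain ⟨f, u, θ, hf, hfj, hu, hθ, hfu⟩ := ih (by omega)
    obtain ⟨i, hi⟩ : ∃ i, j - m = i + 1 := ⟨j - (m + 1), by omega⟩
    have hij : i < j := by omega
    have hi' : j - (m + 1) = i := by omega
    rw [hi] at hθ
    rw [hi']
    obtain ⟨g, hgφ, hg, hgi⟩ := hint i hij
    have hgd : g.degree = i := by rw [degree_eq_natDegree hg.1.ne_zero, hgi]
    have hfd : f.degree = j := by rw [degree_eq_natDegree hf.1.ne_zero, hfj]
    obtain ⟨s, hs⟩ := hfrac (θ.coeff i)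
    set r := θ.coeff i - φ s with hr
    set θ' := θ - C (θ.coeff i) * g with hθ'
    have hθ'd : θ'.degree < (i : WithBot ℕ) := degree_sub_C_coeff_mul_lt hθ hg.1 hgi
    set u' := u + C (φ s) * g with hu'
    have hu'φ : u' ∈ (mapRingHom φ).range := add_mem hu (mul_mem (C_mem_range s) hgφ)
    have hfu' : f = u' + (C r * g + θ') := by
      rw [hfu, hu', hθ', hr, C_sub]; ring
    have hrg : (C r * g).degree < (j : WithBot ℕ) :=
      degree_C_mul_lt _ (by rw [hgd]; exact_mod_cast hij)
    rcases le_or_gt (w (C r * g)) (w f) with hle | hlt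
    · have hlt' : (-(C r * g)).degree < f.degree := by rwa [degree_neg, hfd]
      have hnd : (f + -(C r * g)).natDegree = j :=
        (natDegree_eq_of_degree_eq (degree_add_eq_left_of_degree_lt hlt')).trans hfj
      refine ⟨f + -(C r * g), u', θ', ⟨hf.1.add_of_left hlt', fun p hp hpd => ?_⟩, hnd, hu'φ,
        hθ'd, by rw [hfu']; ring⟩
      refine le_trans ?_ (hf.2 p hp (by rw [hpd, hnd, hfj]))
      exact w.map_add_le le_rfl (by rwa [Valuation.map_neg])
    · exfalso
      obtain ⟨hf0, a, haj, haw, hPa⟩ := hexp f hf hfj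
      set v := C r * g + θ' with hv
      have hvd : v.degree < ((i + 1 : ℕ) : WithBot ℕ) := by
        refine degree_add_lt (degree_C_mul_lt _ ?_) (hθ'd.trans ?_)
        · rw [hgd]; exact_mod_cast Nat.lt_succ_self i
        · exact_mod_cast Nat.lt_succ_self i
      have hvi : v.natDegree ≤ i := by
        rw [natDegree_le_iff_degree_le]
        exact Order.le_of_lt_succ (by exact_mod_cast hvd)
      have hvj : v.degree < f.degree := by
        rw [hfd]; exact hvd.trans_le (by exact_mod_cast hij)
      have hu'm : u'.Monic := by
        have : u' = f + -v := by rw [hfu']; ring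
        rw [this]
        exact hf.1.add_of_left (by rwa [degree_neg])
      have hu'j : u'.natDegree = j := by
        have : u' = f + -v := by rw [hfu']; ring
        rw [this, natDegree_eq_of_degree_eq
          (degree_add_eq_left_of_degree_lt (by rwa [degree_neg])), hfj]
      have haj' : a.natDegree ≤ j - 1 := by
        rcases eq_or_ne a 0 with rfl | ha0
        · simp
        · rw [← natDegree_lt_iff_degree_lt ha0] at haj
          omega
      obtain ⟨t₁, ht₁, e₁⟩ := exists_add_pow_eq hu'j.le (hvi.trans hij.le) d
      obtain ⟨t₂, ht₂, e₂⟩ := exists_add_pow_eq' hu'j.le (hvi.trans hij.le) d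
      rw [← hfu'] at e₁ e₂
      have hmul : (((d + 2 : ℕ) : K[X]) * v + a) * u' ^ (d + 1) = (P - u' ^ (d + 2)) +
          (-(v ^ 2 * t₂) + -(a * (v * t₁)) +
            -(P - f ^ (d + 2) - a * f ^ (d + 1))) := by
        rw [e₁, e₂]; ring
      have hjd : (d + 1) * j = d * j + j := by ring
      obtain ⟨Q, hQ, hQi⟩ := exists_degree_sub_lt_of_mul_eq (i := i) hφ (hu'm.pow (d + 1))
        (by rw [hu'm.natDegree_pow, hu'j]) (pow_mem hu'φ _) (sub_mem hP (pow_mem hu'φ _))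
        (by
          refine degree_add_lt (degree_add_lt ?_ ?_) ?_
          · rw [degree_neg]
            refine degree_lt_of_natDegree_lt ?_
            have := natDegree_mul_le_of_le (natDegree_pow_le_of_le 2 hvi) ht₂
            omega
          · rw [degree_neg]
            refine degree_lt_of_natDegree_lt ?_
            have := natDegree_mul_le_of_le haj' (natDegree_mul_le_of_le hvi ht₁)
            omega
          · rw [degree_neg]
            exact hPa.trans_le (by exact_mod_cast Nat.le_add_right _ _)) hmul
      set θ₃ := ((d + 2 : ℕ) : K[X]) * v + a - Q with hθ₃
      have hcast' : ((d + 2 : ℕ) : K[X]) = C ((d + 2 : ℕ) : K) := (C_eq_natCast _).symm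
      have hQj : Q.degree < (j : WithBot ℕ) := by
        have : Q = C ((d + 2 : ℕ) : K) * v + a - θ₃ := by rw [hθ₃, hcast']; ring
        rw [this]
        refine degree_sub_lt_of_lt (degree_add_lt (degree_C_mul_lt _ (by rwa [← hfd])) haj)
          (hQi.trans (by exact_mod_cast hij))
      have hDr : w (C (-((d + 2 : ℕ) : K) * r)) = w (C r) := by
        rw [neg_mul, C_neg, Valuation.map_neg, C_mul, map_mul, hcast _ (by omega), one_mul]
      have hEa := le_map_add_of_mem_range hone hint hg hgi (ρ := -((d + 2 : ℕ) : K) * r)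
        (by rw [hDr]; exact hs) hQ hQj (θ := θ₃ - C ((d + 2 : ℕ) : K) * θ')
        (degree_sub_lt_of_lt hQi (degree_C_mul_lt _ hθ'd))
      have ha : Q + C (-((d + 2 : ℕ) : K) * r) * g + (θ₃ - C ((d + 2 : ℕ) : K) * θ') = a := by
        rw [hθ₃, hcast', hv, C_mul, C_neg]; ring
      rw [ha, hDr, ← map_mul] at hEa
      exact absurd (hEa.trans haw) (not_le.2 hlt)

end Integral

section Descent

variable {n : ℕ} {P : K[X]}

lemma exists_isIndependent
    (hres : ∀ a b : K[X], w a ≠ 0 → w a = w b → ∃ c : K, w (a - C c * b) < w a)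
    (hP : P.Monic) (hPn : P.natDegree = n) (hP0 : w P = 0)
    (hne : ∀ A : K[X], A ≠ 0 → A.degree < (n : WithBot ℕ) → w A ≠ 0)
    (hj : IsSpecial w j) (hjn : j < n) (hf : IsMinimal w f) (hfj : f.natDegree = j) :
    ∃ q, 2 ≤ q ∧ q * j ≤ n ∧ IsIndependent w f j q ∧ w f ^ q ∈ valuesBelow w j := by
  classical
  have hf0 : w f ≠ 0 := hne f hf.1.ne_zero (by
    rw [← natDegree_lt_iff_degree_lt hf.1.ne_zero, hfj]; exact hjn)
  have hind : ∀ q, (∀ k, 0 < k → k < q → w f ^ k ∉ valuesBelow w j) → IsIndependent w f j q :=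
    fun q hq => ⟨hf.1, hfj, hj, hf0,
      fun A hA hAj => hne A hA (hAj.trans (by exact_mod_cast hjn)), hq⟩
  have hle : ∀ q, IsIndependent w f j q → q * j ≤ n := by
    intro q hq
    by_contra hcon
    refine hq.map_ne_zero' hP.ne_zero ?_ hP0
    rw [← natDegree_lt_iff_degree_lt hP.ne_zero]
    omega
  have hex : ∃ q, 0 < q ∧ w f ^ q ∈ valuesBelow w j := by
    by_contra! hcon
    have h1 := hle (n + 1) (hind _ fun k hk _ => hcon k hk)
    have h2 : (n + 1) * 1 ≤ (n + 1) * j := Nat.mul_le_mul_left _ hj.pos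
    omega
  obtain ⟨hq0, hq⟩ := Nat.find_spec hex
  have hI := hind (Nat.find hex) fun k hk hlt hmem => Nat.find_min hex hlt ⟨hk, hmem⟩
  refine ⟨Nat.find hex, ?_, hle _ hI, hI, hq⟩
  by_contra hcon
  have h1 : Nat.find hex = 1 := by omega
  rw [h1, pow_one] at hq
  obtain ⟨A, -, hA, he⟩ := hq
  refine hf.ne_of_degree_lt hres hf0 (h := A) ?_ he.symm
  rwa [degree_eq_natDegree hf.1.ne_zero, hfj]

lemma exists_degree_sub_lt_of_monic (hf : f.Monic) (hfj : f.natDegree = j) (hj : 0 < j)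
    (hf0 : w f ≠ 0) {d : ℕ} (hP : P.Monic) (hPn : P.natDegree = (d + 2) * j)
    (hPb : P ∈ adicBall w f (w f ^ (d + 2)) ((d + 2) * j)) :
    ∃ a : K[X], a.degree < (j : WithBot ℕ) ∧ w a ≤ w f ∧
      (P - f ^ (d + 2) - a * f ^ (d + 1)).degree < (((d + 1) * j : ℕ) : WithBot ℕ) := by
  obtain ⟨c, a, haj, haw, h⟩ := exists_degree_sub_lt_of_mem_adicBall hf hfj hj hf0 hPb
  have hlt : (d + 1) * j ≤ (d + 2) * j := Nat.mul_le_mul_right _ (by omega)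
  have h1 : P.coeff ((d + 2) * j) = 1 := by rw [← hPn]; exact hP
  have h2 : (f ^ (d + 2)).coeff ((d + 2) * j) = 1 := by
    have : (f ^ (d + 2)).natDegree = (d + 2) * j := by rw [hf.natDegree_pow, hfj]
    rw [← this]; exact hf.pow _
  have h3 : (a * f ^ (d + 1)).coeff ((d + 2) * j) = 0 := by
    refine coeff_eq_zero_of_degree_lt ((degree_mul_pow_lt hf haj).trans_le ?_)
    rw [hfj]
    exact_mod_cast (by ring : j + (d + 1) * j = (d + 2) * j).le
  have h4 := coeff_eq_zero_of_degree_lt (h.trans_le (by exact_mod_cast hlt))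
  rw [coeff_sub, coeff_sub, coeff_C_mul, h1, h2, h3, mul_one, sub_zero, sub_eq_zero] at h4
  rw [← h4, C_1, one_mul] at h
  exact ⟨a, haj, haw, h⟩

variable {R : Type*} [CommRing R] {φ : R →+* K}

lemma mem_adicBall_and_hasIntegralMinimals
    (hres : ∀ a b : K[X], w a ≠ 0 → w a = w b → ∃ c : K, w (a - C c * b) < w a)
    (hone : ∀ r, φ r ≠ 0 → 1 ≤ w (C (φ r))) (hφ : Function.Injective φ)
    (hfrac : ∀ b : K, ∃ r, w (C (b - φ r)) < 1)
    (hcast : ∀ d : ℕ, d ≠ 0 → w (C (d : K)) = 1)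
    (hPφ : P ∈ (mapRingHom φ).range) (hP : P.Monic) (hPn : P.natDegree = n) (hP0 : w P = 0)
    (hne : ∀ A : K[X], A ≠ 0 → A.degree < (n : WithBot ℕ) → w A ≠ 0)
    (hmin : ∀ k < n, ∃ f, IsMinimal w f ∧ f.natDegree = k)
    (hj : IsSpecial w j) (hjn : j ≤ n) :
    j ∣ n ∧ (j < n → ∀ f, IsMinimal w f → f.natDegree = j → P ∈ adicBall w f (w f ^ (n / j)) n) ∧
      (HasIntegralMinimals w φ j → HasIntegralMinimals w φ n) := by
  induction hm : n - j using Nat.strong_induction_on generalizing j with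
  | _ m ih =>
  rcases eq_or_lt_of_le hjn with rfl | hjn
  · exact ⟨dvd_rfl, fun h => absurd h (lt_irrefl _), id⟩
  have hj0 := hj.pos
  have step : ∀ f, IsMinimal w f → f.natDegree = j → j ∣ n ∧ P ∈ adicBall w f (w f ^ (n / j)) n ∧
      ∃ q, IsIndependent w f j q ∧
        (HasIntegralMinimals w φ (q * j) → HasIntegralMinimals w φ n) := by
    intro f hf hfj
    obtain ⟨q, hq2, hqn, hI, hq⟩ := exists_isIndependent hres hP hPn hP0 hne hj hjn hf hfj
    have hlt : 2 * j ≤ q * j := Nat.mul_le_mul_right _ hq2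
    obtain ⟨⟨d, hd⟩, h2, h3⟩ := ih (n - q * j) (by omega) (hI.isSpecial_mul (by omega) hq) hqn rfl
    have hdiv : n / j = d * q := by
      rw [hd, mul_comm q j, mul_assoc, Nat.mul_div_cancel_left _ hj0, mul_comm]
    refine ⟨⟨q * d, by rw [hd]; ring⟩, ?_, q, hI, h3⟩
    rw [hdiv]
    rcases eq_or_lt_of_le hqn with hqn | hqn
    · have hd1 : d = 1 := by
        have : q * j * d = q * j * 1 := by rw [← hd, mul_one, hqn]
        exact Nat.eq_of_mul_eq_mul_left (by omega) this
      have := hI.mem_adicBall_of_monic hP (hPn.trans hqn.symm) (by rw [hP0]; exact zero_le)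
      rw [hd1, one_mul]
      rwa [hqn] at this
    · obtain ⟨g, hg, hgd⟩ := hmin _ hqn
      have hg0 : w g ≠ 0 := hne g hg.1.ne_zero (by
        rw [← natDegree_lt_iff_degree_lt hg.1.ne_zero, hgd]; exact hqn)
      have hle : w g ≤ w f ^ q := by
        rw [← map_pow]
        exact hg.2 _ (hf.1.pow q) (by rw [hf.1.natDegree_pow, hfj, hgd])
      have h4 := h2 hqn g hg hgd
      have hdiv' : n / (q * j) = d := by
        rw [hd, Nat.mul_div_cancel_left _ (by omega)]
      have hn : n = d * (q * j) := by rw [hd, mul_comm]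
      rw [hdiv'] at h4
      have h5 := hI.adicBall_le hq2 hg.1 hgd hg0 hle d
      rw [← hn] at h5
      exact h5 h4
  obtain ⟨f, hf, hfj⟩ := hmin j hjn
  obtain ⟨hdvd, -, -⟩ := step f hf hfj
  refine ⟨hdvd, fun _ f hf hfj => (step f hf hfj).2.1, fun hint => ?_⟩
  obtain ⟨d, hd⟩ : ∃ d, n = (d + 2) * j := by
    obtain ⟨e, he⟩ := hdvd
    have : 2 ≤ e := by
      by_contra hcon
      have : j * e ≤ j * 1 := Nat.mul_le_mul_left _ (by omega)
      omega
    exact ⟨e - 2, by rw [Nat.sub_add_cancel this, he, mul_comm]⟩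
  have hdiv : n / j = d + 2 := by rw [hd, Nat.mul_div_cancel _ hj0]
  obtain ⟨f, hfφ, hf, hfj⟩ := exists_isMinimal_mem_range hone hφ hfrac hcast hint hPφ (d := d)
    (fun f hf hfj => by
      have hf0 : w f ≠ 0 := hne f hf.1.ne_zero (by
        rw [← natDegree_lt_iff_degree_lt hf.1.ne_zero, hfj]; exact hjn)
      refine ⟨hf0, exists_degree_sub_lt_of_monic hf.1 hfj hj0 hf0 hP (hPn.trans hd) ?_⟩
      have := (step f hf hfj).2.1
      rwa [hdiv, hd] at this) (hmin j hjn)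
  obtain ⟨-, -, q, hI, hstep⟩ := step f hf hfj
  refine hstep fun k hk => ?_
  obtain ⟨g, hgφ, hg, hgd⟩ := hint (k % j) (Nat.mod_lt _ hj0)
  have hl : k / j < q := (Nat.div_lt_iff_lt_mul hj0).2 hk
  refine ⟨g * f ^ (k / j), mul_mem hgφ (pow_mem hfφ _),
    hI.isMinimal_mul_pow hl hg (by rw [hgd]; exact Nat.mod_lt _ hj0), ?_⟩
  rw [natDegree_mul_pow hf.1 hg.1.ne_zero, hgd, hfj, mul_comm, Nat.mod_add_div]

lemma isSpecial_one : IsSpecial w 1 := by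
  have key : ∀ γ, γ ∈ valuesBelow w 1 ↔ ∃ c : K, c ≠ 0 ∧ w (C c) = γ := by
    intro γ
    constructor
    · rintro ⟨A, hA0, hA, rfl⟩
      have : A = C (A.coeff 0) := eq_C_of_natDegree_eq_zero (by
        rw [← natDegree_lt_iff_degree_lt hA0] at hA; omega)
      refine ⟨A.coeff 0, ?_, by rw [← this]⟩
      intro h
      rw [h, C_0] at this
      exact hA0 this
    · rintro ⟨c, hc, rfl⟩
      refine ⟨C c, by simpa using hc, ?_, rfl⟩
      rw [degree_C hc]
      exact_mod_cast one_pos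
  refine ⟨one_pos, fun γ hγ δ hδ => ?_, fun γ hγ => ?_⟩
  · rw [key] at *
    obtain ⟨c, hc, rfl⟩ := hγ
    obtain ⟨e, he, rfl⟩ := hδ
    exact ⟨c * e, mul_ne_zero hc he, by rw [C_mul, map_mul]⟩
  · rw [key] at *
    obtain ⟨c, hc, rfl⟩ := hγ
    exact ⟨c⁻¹, inv_ne_zero hc, map_C_inv c⟩

lemma isMinimal_one : IsMinimal w 1 := by
  refine ⟨monic_one, fun g hg hd => ?_⟩
  rw [hg.natDegree_eq_zero.1 (by simpa using hd)]

/-- Integral minimal polynomials exist in all degrees below `n`. -/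
lemma hasIntegralMinimals
    (hres : ∀ a b : K[X], w a ≠ 0 → w a = w b → ∃ c : K, w (a - C c * b) < w a)
    (hone : ∀ r, φ r ≠ 0 → 1 ≤ w (C (φ r))) (hφ : Function.Injective φ)
    (hfrac : ∀ b : K, ∃ r, w (C (b - φ r)) < 1)
    (hcast : ∀ d : ℕ, d ≠ 0 → w (C (d : K)) = 1)
    (hPφ : P ∈ (mapRingHom φ).range) (hP : P.Monic) (hPn : P.natDegree = n) (hP0 : w P = 0)
    (hne : ∀ A : K[X], A ≠ 0 → A.degree < (n : WithBot ℕ) → w A ≠ 0)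
    (hmin : ∀ k < n, ∃ f, IsMinimal w f ∧ f.natDegree = k) (hn : 0 < n) :
    HasIntegralMinimals w φ n := by
  refine (mem_adicBall_and_hasIntegralMinimals hres hone hφ hfrac hcast hPφ hP hPn hP0 hne hmin
    isSpecial_one hn).2.2 fun k hk => ⟨1, one_mem _, isMinimal_one, ?_⟩
  rw [natDegree_one]
  omega

/-- Integral polynomials of degree less than `n` do not take the value of `C ρ * f` for `f` minimal
and `ρ` a constant of value less than one. -/
lemma map_C_mul_ne_of_mem_range
    (hres : ∀ a b : K[X], w a ≠ 0 → w a = w b → ∃ c : K, w (a - C c * b) < w a)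
    (hone : ∀ r, φ r ≠ 0 → 1 ≤ w (C (φ r))) (hint : HasIntegralMinimals w φ n)
    (hf : IsMinimal w f) (hf0 : w f ≠ 0) {ρ : K} (hρ : w (C ρ) < 1) (hρ0 : ρ ≠ 0)
    {Q : K[X]} (hQ : Q ∈ (mapRingHom φ).range) (hQn : Q.degree < (n : WithBot ℕ)) :
    w Q ≠ w (C ρ * f) := by
  intro he
  have hρf : w (C ρ * f) ≠ 0 := by
    rw [map_mul]; exact mul_ne_zero (map_C_ne_zero hρ0) hf0
  obtain ⟨c, hc⟩ := hres Q (C ρ * f) (by rwa [he]) he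
  have hc1 : w (C c) = 1 := by
    have h1 : w (C c * (C ρ * f)) = w Q := by
      by_contra hcon
      rw [Valuation.map_sub_swap, sub_eq_add_neg,
        Valuation.map_add_of_distinct_val w (by rwa [Valuation.map_neg]), Valuation.map_neg] at hc
      exact absurd (le_max_right _ _) (not_le.2 hc)
    rw [he, map_mul] at h1
    exact mul_right_cancel₀ hρf (h1.trans (one_mul _).symm)
  have hcρ : w (C (-(c * ρ))) = w (C ρ) := by
    rw [C_neg, Valuation.map_neg, C_mul, map_mul, hc1, one_mul]
  have := le_map_add_of_mem_range hone hint hf rfl (ρ := -(c * ρ)) (by rwa [hcρ]) hQ hQn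
    (degree_zero_lt _)
  have e : Q + C (-(c * ρ)) * f + 0 = Q - C c * (C ρ * f) := by rw [C_neg, C_mul]; ring
  rw [hcρ, ← map_mul, ← he, e] at this
  exact absurd hc (not_lt.2 this)

end Descent

end Valuation

section Basis

open WithZero

variable {K : Type*} [Field K] {w : Valuation K[X] ℤᵐ⁰} {n : ℕ} {T : Fin n → K[X]}

lemma map_le_map_sum {Γ₀ : Type*} [LinearOrderedCommGroupWithZero Γ₀] {w : Valuation K[X] Γ₀}
    (hw : ∀ i k, i ≠ k → ∀ b c, b ≠ 0 → c ≠ 0 → w (C b * T i) ≠ w (C c * T k))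
    (b : Fin n → K) (i : Fin n) : w (C (b i) * T i) ≤ w (∑ k, C (b k) * T k) := by
  classical
  obtain ⟨m, -, hm⟩ := Finset.exists_max_image Finset.univ (fun k => w (C (b k) * T k))
    ⟨i, Finset.mem_univ i⟩
  rcases eq_or_ne (w (C (b m) * T m)) 0 with h0 | h0
  · exact ((hm i (Finset.mem_univ i)).trans h0.le).trans zero_le
  · have hbm : b m ≠ 0 := by rintro h; simp [h] at h0
    rw [Valuation.map_sum_eq_of_lt w (Finset.mem_univ m)]
    · exact hm i (Finset.mem_univ i)
    · intro k hk
      have hkm : k ≠ m := by simpa using hk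
      refine lt_of_le_of_ne (hm k (Finset.mem_univ k)) ?_
      rcases eq_or_ne (b k) 0 with hbk | hbk
      · rw [hbk, C_0, zero_mul, map_zero]
        exact h0.symm
      · exact hw k m hkm _ _ hbk hbm

lemma exists_eq_sum {Γ₀ : Type*} [LinearOrderedCommGroupWithZero Γ₀] {w : Valuation K[X] Γ₀}
    (hw : ∀ i k, i ≠ k → ∀ b c, b ≠ 0 → c ≠ 0 → w (C b * T i) ≠ w (C c * T k))
    (hT : ∀ i, (T i).degree < (n : WithBot ℕ)) (hT0 : ∀ i, w (T i) ≠ 0) {A : K[X]}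
    (hA : A.degree < (n : WithBot ℕ)) : ∃ b : Fin n → K, A = ∑ k, C (b k) * T k := by
  let T' : Fin n → degreeLT K n := fun i => ⟨T i, mem_degreeLT.2 (hT i)⟩
  have : FiniteDimensional K (degreeLT K n) :=
    LinearEquiv.finiteDimensional (degreeLTEquiv K n).symm
  have hfin : Fintype.card (Fin n) = Module.finrank K (degreeLT K n) := by
    rw [(degreeLTEquiv K n).finrank_eq, Module.finrank_fin_fun, Fintype.card_fin]
  have hli : LinearIndependent K T' := by
    rw [Fintype.linearIndependent_iff]
    intro b hb i
    have h1 : ∑ k, C (b k) * T k = 0 := by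
      have := congrArg Subtype.val hb
      simpa [T', smul_eq_C_mul] using this
    have h2 := map_le_map_sum hw b i
    rw [h1, map_zero, map_mul] at h2
    by_contra hbi
    exact mul_ne_zero (map_C_ne_zero hbi) (hT0 i) (le_zero_iff.1 h2)
  have hspan := hli.span_eq_top_of_card_eq_finrank' hfin
  have hmem : (⟨A, mem_degreeLT.2 hA⟩ : degreeLT K n) ∈ Submodule.span K (Set.range T') := by
    rw [hspan]; trivial
  obtain ⟨b, hb⟩ := (Submodule.mem_span_range_iff_exists_fun K).1 hmem
  refine ⟨b, ?_⟩
  have := congrArg Subtype.val hb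
  simpa [T', smul_eq_C_mul] using this.symm

lemma map_ne_zero_of_degree_lt {Γ₀ : Type*} [LinearOrderedCommGroupWithZero Γ₀]
    {w : Valuation K[X] Γ₀}
    (hw : ∀ i k, i ≠ k → ∀ b c, b ≠ 0 → c ≠ 0 → w (C b * T i) ≠ w (C c * T k))
    (hT : ∀ i, (T i).degree < (n : WithBot ℕ)) (hT0 : ∀ i, w (T i) ≠ 0) {A : K[X]} (hA0 : A ≠ 0)
    (hA : A.degree < (n : WithBot ℕ)) : w A ≠ 0 := by
  obtain ⟨b, rfl⟩ := exists_eq_sum hw hT hT0 hA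
  obtain ⟨i, hi⟩ : ∃ i, b i ≠ 0 := by
    by_contra! hb
    simp [hb] at hA0
  intro h0
  have := map_le_map_sum hw b i
  rw [h0, map_mul] at this
  exact mul_ne_zero (map_C_ne_zero hi) (hT0 i) (le_zero_iff.1 this)

lemma exists_isMinimal
    (hw : ∀ i k, i ≠ k → ∀ b c, b ≠ 0 → c ≠ 0 → w (C b * T i) ≠ w (C c * T k))
    (hT : ∀ i, (T i).degree < (n : WithBot ℕ)) (hT0 : ∀ i, w (T i) ≠ 0) {j : ℕ} (hj : j < n) :
    ∃ f, IsMinimal w f ∧ f.natDegree = j := by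
  have hne : ∀ f : K[X], f.Monic → f.natDegree = j → w f ≠ 0 := fun f hf hfj =>
    map_ne_zero_of_degree_lt hw hT hT0 hf.ne_zero (by
      rwa [← natDegree_lt_iff_degree_lt hf.ne_zero, hfj])
  obtain ⟨z, hz⟩ := (Set.finite_range fun i =>
    log (w (T i)) - log (w (C ((T i).coeff j)))).bddBelow
  have hbdd : ∀ f : K[X], f.Monic → f.natDegree = j → z ≤ log (w f) := by
    intro f hf hfj
    have hfn : f.degree < (n : WithBot ℕ) := by
      rwa [← natDegree_lt_iff_degree_lt hf.ne_zero, hfj]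
    obtain ⟨b, hb⟩ := exists_eq_sum hw hT hT0 hfn
    have h1 : (1 : ℤᵐ⁰) ≤ w (C (f.coeff j)) := by
      rw [← hfj, hf.coeff_natDegree, C_1, map_one]
    obtain ⟨i, hi⟩ : ∃ i, 1 ≤ w (C (b i * (T i).coeff j)) := by
      by_contra! hcon
      rw [hb, finsetSum_coeff, map_sum] at h1
      refine absurd h1 (not_le.2 (w.map_sum_lt one_ne_zero fun i _ => ?_))
      rw [coeff_C_mul]
      exact hcon i
    rw [C_mul, map_mul] at hi
    have hprod : w (C (b i)) * w (C ((T i).coeff j)) ≠ 0 := (zero_lt_one.trans_le hi).ne'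
    obtain ⟨hb0, hc0⟩ := mul_ne_zero_iff.1 hprod
    have h2 := map_le_map_sum hw b i
    rw [← hb, map_mul, ← log_le_log (mul_ne_zero hb0 (hT0 i)) (hne f hf hfj),
      log_mul hb0 (hT0 i)] at h2
    rw [← log_le_log one_ne_zero hprod, log_one, log_mul hb0 hc0] at hi
    have h3 : z ≤ log (w (T i)) - log (w (C ((T i).coeff j))) := hz ⟨i, rfl⟩
    omega
  obtain ⟨m, ⟨f, hf, hfj, hfm⟩, hm⟩ := Int.exists_least_of_bdd
    (P := fun m => ∃ f : K[X], f.Monic ∧ f.natDegree = j ∧ log (w f) = m)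
    ⟨z, by rintro _ ⟨f, hf, hfj, rfl⟩; exact hbdd f hf hfj⟩
    ⟨_, X ^ j, monic_X_pow j, natDegree_X_pow j, rfl⟩
  refine ⟨f, ⟨hf, fun g hg hgd => ?_⟩, hfj⟩
  rw [hfj] at hgd
  rw [← log_le_log (hne f hf hfj) (hne g hg hgd), hfm]
  exact hm _ ⟨g, hg, hgd, rfl⟩

end Basis

section Curve

open WithZero

variable {k : Type*} [Field k]

open Classical in
/-- The valuation of `k(t)` extending the degree of polynomials. -/
noncomputable def degreeValuation (k : Type*) [Field k] : Valuation (RatFunc k) ℤᵐ⁰ :=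
  RatFunc.inftyValuation k

lemma degreeValuation_algebraMap {f : k[X]} (hf : f ≠ 0) :
    degreeValuation k (algebraMap k[X] (RatFunc k) f) = exp (f.natDegree : ℤ) := by
  classical
  exact RatFunc.inftyValuation.polynomial k hf

lemma degreeValuation_algebraMap_lt {f g : k[X]} (hg : g ≠ 0) (h : f.degree < g.degree) :
    degreeValuation k (algebraMap k[X] (RatFunc k) f) <
      degreeValuation k (algebraMap k[X] (RatFunc k) g) := by
  rw [degreeValuation_algebraMap hg]
  rcases eq_or_ne f 0 with rfl | hf
  · rw [map_zero, map_zero]; exact exp_pos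
  · rw [degreeValuation_algebraMap hf, exp_lt_exp]
    exact_mod_cast natDegree_lt_natDegree hf h

lemma exists_degreeValuation_sub_lt (x : RatFunc k) :
    ∃ r : k[X], degreeValuation k (x - algebraMap k[X] (RatFunc k) r) < 1 := by
  obtain ⟨a, b, hb, rfl⟩ := IsFractionRing.div_surjective (A := k[X]) x
  have hb0 : b ≠ 0 := nonZeroDivisors.ne_zero hb
  have hb' : algebraMap k[X] (RatFunc k) b ≠ 0 := by simpa using hb0
  refine ⟨a / b, ?_⟩
  have h : algebraMap k[X] (RatFunc k) a / algebraMap k[X] (RatFunc k) b -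
      algebraMap k[X] (RatFunc k) (a / b) =
        algebraMap k[X] (RatFunc k) (a % b) / algebraMap k[X] (RatFunc k) b := by
    rw [eq_div_iff hb', sub_mul, div_mul_cancel₀ _ hb', ← map_mul, ← map_sub]
    congr 1
    have := EuclideanDomain.div_add_mod a b
    linear_combination -this
  rw [h, map_div₀, div_lt_one₀ (zero_lt_iff.2 ((Valuation.ne_zero_iff _).2 hb'))]
  exact degreeValuation_algebraMap_lt hb0 (EuclideanDomain.mod_lt a hb0)

lemma exists_degreeValuation_sub_C_mul_lt {x y : RatFunc k} (hx : degreeValuation k x ≠ 0)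
    (hxy : degreeValuation k x = degreeValuation k y) :
    ∃ c : k, degreeValuation k (x - algebraMap k[X] (RatFunc k) (C c) * y) <
      degreeValuation k x := by
  have hy : y ≠ 0 := by
    rw [hxy] at hx
    exact (Valuation.ne_zero_iff _).1 hx
  obtain ⟨r, hr⟩ := exists_degreeValuation_sub_lt (x / y)
  have h1 : degreeValuation k (x / y) = 1 := by rw [map_div₀, hxy, div_self (by rwa [← hxy])]
  have hr1 : degreeValuation k (algebraMap k[X] (RatFunc k) r) ≤ 1 := by
    have : algebraMap k[X] (RatFunc k) r = x / y - (x / y - algebraMap k[X] (RatFunc k) r) := by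
      ring
    rw [this]
    exact (degreeValuation k).map_sub_le h1.le hr.le
  have hrC : r = C (r.coeff 0) := by
    refine eq_C_of_natDegree_eq_zero ?_
    rcases eq_or_ne r 0 with rfl | hr0
    · simp
    · rw [degreeValuation_algebraMap hr0, ← exp_zero, exp_le_exp] at hr1
      omega
  refine ⟨r.coeff 0, ?_⟩
  have e : x - algebraMap k[X] (RatFunc k) (C (r.coeff 0)) * y =
      (x / y - algebraMap k[X] (RatFunc k) r) * y := by
    rw [← hrC, sub_mul, div_mul_cancel₀ _ hy]
  rw [e, map_mul, hxy]
  exact mul_lt_of_lt_one_left (zero_lt_iff.2 (by rwa [← hxy])) hr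

end Curve

section Plane

open WithZero

variable {k : Type*} [Field k] {p q : k[X]}

lemma exists_monic_eval₂_eq_zero (hp : 0 < p.natDegree) (q : k[X]) :
    ∃ P : k[X][X], P.Monic ∧ P.natDegree = p.natDegree ∧ P.eval₂ (compRingHom p) q = 0 := by
  have hp0 : p.leadingCoeff ≠ 0 := leadingCoeff_ne_zero.2 (by rintro rfl; simp at hp)
  set g : k[X][X] := C (C p.leadingCoeff⁻¹) * (p.map C - C X) with hg
  have hd : (C X : k[X][X]).degree < (p.map C).degree := by
    rw [degree_map_eq_of_injective C_injective]
    exact degree_C_le.trans_lt (natDegree_pos_iff_degree_pos.1 hp)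
  have hdeg : (p.map C - C X).natDegree = p.natDegree := by
    rw [natDegree_eq_of_degree_eq (degree_sub_eq_left_of_degree_lt hd),
      natDegree_map_eq_of_injective C_injective]
  have hlead : (p.map C - C X).leadingCoeff = C p.leadingCoeff := by
    rw [leadingCoeff_sub_of_degree_lt hd, leadingCoeff_map_of_injective C_injective]
  have hunit : (C p.leadingCoeff⁻¹ : k[X]) * C p.leadingCoeff = 1 := by
    rw [← C_mul, inv_mul_cancel₀ hp0, C_1]
  have hgm : g.Monic := by
    rw [Monic, hg, leadingCoeff_mul, leadingCoeff_C, hlead, hunit]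
  have hgd : g.natDegree = p.natDegree := by
    rw [hg, natDegree_C_mul, hdeg]
    simpa using hp0
  have hg0 : g.eval₂ (compRingHom p) X = 0 := by
    have : (compRingHom p).comp C = C := by ext; simp
    rw [hg, eval₂_mul, eval₂_sub, eval₂_map, this, eval₂_C_X]
    simp
  have hfree : Module.Free k[X] (AdjoinRoot g) := hgm.free_adjoinRoot
  have hfin : Module.Finite k[X] (AdjoinRoot g) := hgm.finite_adjoinRoot
  have hrank : Module.finrank k[X] (AdjoinRoot g) = p.natDegree := by
    rw [(AdjoinRoot.powerBasis' hgm).finrank, AdjoinRoot.powerBasis'_dim, hgd]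
  let α : AdjoinRoot g := AdjoinRoot.mk g (q.map C)
  refine ⟨(Algebra.lmul k[X] _ α).charpoly, LinearMap.charpoly_monic _, ?_, ?_⟩
  · rw [LinearMap.charpoly_natDegree, hrank]
  · have h := congrArg (AdjoinRoot.lift (compRingHom p) X hg0)
      (Algebra.aeval_self_charpoly_lmul (R := k[X]) α)
    have hα : AdjoinRoot.lift (compRingHom p) X hg0 α = q := by
      have : (compRingHom p).comp C = C := by ext; simp
      rw [AdjoinRoot.lift_mk, eval₂_map, this, eval₂_C_X]
    rw [map_zero, aeval_def, hom_eval₂, hα, AdjoinRoot.algebraMap_eq, AdjoinRoot.lift_comp_of] at h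
    exact h

/-- Substitution of a nonconstant polynomial in rational functions. -/
noncomputable def compRatFunc (hp : 0 < p.natDegree) : RatFunc k →+* RatFunc k :=
  IsFractionRing.lift (A := k[X]) (g := (algebraMap k[X] (RatFunc k)).comp (compRingHom p)) (by
    rw [RingHom.coe_comp]
    refine (IsFractionRing.injective k[X] (RatFunc k)).comp ?_
    rw [injective_iff_map_eq_zero]
    intro f hf
    rw [coe_compRingHom_apply, comp_eq_zero_iff] at hf
    refine hf.resolve_right fun h => ?_
    rw [h.2, natDegree_C] at hp
    exact lt_irrefl _ hp)

lemma compRatFunc_algebraMap (hp : 0 < p.natDegree) (f : k[X]) :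
    compRatFunc hp (algebraMap k[X] (RatFunc k) f) =
      algebraMap k[X] (RatFunc k) (f.comp p) := by
  rw [compRatFunc, IsFractionRing.lift_algebraMap]
  rfl

lemma degreeValuation_compRatFunc (hp : 0 < p.natDegree) (x : RatFunc k) :
    degreeValuation k (compRatFunc hp x) = degreeValuation k x ^ p.natDegree := by
  have key : ∀ f : k[X], degreeValuation k (compRatFunc hp (algebraMap k[X] (RatFunc k) f)) =
      degreeValuation k (algebraMap k[X] (RatFunc k) f) ^ p.natDegree := by
    intro f
    rcases eq_or_ne f 0 with rfl | hf
    · simp [hp.ne']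
    · have hfp : f.comp p ≠ 0 := by
        rw [Ne, comp_eq_zero_iff]
        rintro (h | h)
        · exact hf h
        · rw [h.2, natDegree_C] at hp
          exact lt_irrefl _ hp
      rw [compRatFunc_algebraMap, degreeValuation_algebraMap hf, degreeValuation_algebraMap hfp,
        natDegree_comp, ← exp_nsmul, nsmul_eq_mul]
      congr 1
      push_cast
      ring
  obtain ⟨a, b, -, rfl⟩ := IsFractionRing.div_surjective (A := k[X]) x
  rw [map_div₀, map_div₀, map_div₀, key, key, div_pow]

/-- The degree of the values of bivariate polynomials, with coefficients rational in the first
variable, at `(p, q)`. -/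
noncomputable def curveValuation (hp : 0 < p.natDegree) (q : k[X]) :
    Valuation (RatFunc k)[X] ℤᵐ⁰ :=
  (degreeValuation k).comap (eval₂RingHom (compRatFunc hp) (algebraMap k[X] (RatFunc k) q))

lemma curveValuation_map (hp : 0 < p.natDegree) (F : k[X][X]) :
    curveValuation hp q (F.map (algebraMap k[X] (RatFunc k))) =
      degreeValuation k (algebraMap k[X] (RatFunc k) (F.eval₂ (compRingHom p) q)) := by
  have h : (compRatFunc hp).comp (algebraMap k[X] (RatFunc k)) =
      (algebraMap k[X] (RatFunc k)).comp (compRingHom p) :=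
    RingHom.ext fun f => compRatFunc_algebraMap hp f
  rw [curveValuation, Valuation.comap_apply, coe_eval₂RingHom, eval₂_map, h, hom_eval₂]

lemma curveValuation_C (hp : 0 < p.natDegree) (x : RatFunc k) :
    curveValuation hp q (C x) = degreeValuation k x ^ p.natDegree := by
  rw [curveValuation, Valuation.comap_apply, coe_eval₂RingHom, eval₂_C,
    degreeValuation_compRatFunc]

lemma curveValuation_res (hp : 0 < p.natDegree) (a b : (RatFunc k)[X])
    (ha : curveValuation hp q a ≠ 0) (hab : curveValuation hp q a = curveValuation hp q b) :
    ∃ c : RatFunc k, curveValuation hp q (a - C c * b) < curveValuation hp q a := by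
  obtain ⟨c, hc⟩ := exists_degreeValuation_sub_C_mul_lt ha hab
  refine ⟨algebraMap k[X] (RatFunc k) (C c), ?_⟩
  rw [curveValuation, Valuation.comap_apply, map_sub, map_mul]
  simp only [coe_eval₂RingHom, eval₂_C, compRatFunc_algebraMap, C_comp]
  exact hc

lemma exists_eval₂_eq_of_degree_lt (hp : 0 < p.natDegree)
    (hs : ∀ f : k[X], ∃ F : k[X][X], F.eval₂ (compRingHom p) q = f) (f : k[X]) :
    ∃ F : k[X][X], F.degree < (p.natDegree : WithBot ℕ) ∧ F.eval₂ (compRingHom p) q = f := by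
  obtain ⟨P, hP, hPn, hP0⟩ := exists_monic_eval₂_eq_zero hp q
  obtain ⟨F, rfl⟩ := hs f
  refine ⟨F %ₘ P, ?_, ?_⟩
  · rw [← hPn, ← degree_eq_natDegree hP.ne_zero]
    exact degree_modByMonic_lt F hP
  · conv_rhs => rw [← modByMonic_add_div F P]
    rw [eval₂_add, eval₂_mul, hP0, zero_mul, add_zero]

/-- If `k[p, q] = k[t]` and `deg p > 1`, then subtracting a polynomial in `p` from `q` makes its
degree positive and less than that of `p`. -/
theorem exists_natDegree_sub_comp_lt [CharZero k] (hp : 1 < p.natDegree)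
    (hs : ∀ f : k[X], ∃ F : k[X][X], F.eval₂ (compRingHom p) q = f) :
    ∃ b : k[X], 0 < (q - b.comp p).natDegree ∧ (q - b.comp p).natDegree < p.natDegree := by
  have hp' : 0 < p.natDegree := by omega
  set n := p.natDegree with hn
  set φ := algebraMap k[X] (RatFunc k) with hφ
  have hφi : Function.Injective φ := IsFractionRing.injective k[X] (RatFunc k)
  set w := curveValuation hp' q with hw
  have hwC : ∀ x, w (C x) = degreeValuation k x ^ n := curveValuation_C hp'
  choose T hTd hT using fun i : Fin n => exists_eval₂_eq_of_degree_lt hp' hs (X ^ (i : ℕ))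
  have hwT : ∀ i, w ((T i).map φ) = exp ((i : ℕ) : ℤ) := fun i => by
    rw [hw, curveValuation_map, hT, degreeValuation_algebraMap (pow_ne_zero _ X_ne_zero),
      natDegree_X_pow]
  have hwbT : ∀ i b, b ≠ 0 →
      w (C b * (T i).map φ) = exp (n * log (degreeValuation k b) + (i : ℕ)) := fun i b hb => by
    rw [map_mul, hwT, hwC, exp_add, ← nsmul_eq_mul, exp_nsmul,
      exp_log ((Valuation.ne_zero_iff _).2 hb)]
  have hwne : ∀ i j, i ≠ j → ∀ b c, b ≠ 0 → c ≠ 0 →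
      w (C b * (T i).map φ) ≠ w (C c * (T j).map φ) := by
    intro i j hij b c hb hc h
    rw [hwbT i b hb, hwbT j c hc, exp_inj] at h
    refine hij (Fin.ext ?_)
    have h' := congrArg (· % (n : ℤ)) h
    simp only [Int.mul_add_emod_self_left] at h'
    rw [Int.emod_eq_of_lt (by positivity) (by exact_mod_cast i.2),
      Int.emod_eq_of_lt (by positivity) (by exact_mod_cast j.2)] at h'
    exact_mod_cast h'
  have hTd' : ∀ i, ((T i).map φ).degree < (n : WithBot ℕ) := fun i =>
    degree_map_le.trans_lt (hTd i)
  have hT0 : ∀ i, w ((T i).map φ) ≠ 0 := fun i => by rw [hwT]; exact exp_ne_zero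
  obtain ⟨P, hP, hPn, hP0⟩ := exists_monic_eval₂_eq_zero hp' q
  have hone : ∀ r, φ r ≠ 0 → 1 ≤ w (C (φ r)) := by
    intro r hr
    have hr0 : r ≠ 0 := by rintro rfl; simp at hr
    rw [hwC, degreeValuation_algebraMap hr0]
    refine one_le_pow_of_one_le' ?_ _
    rw [← exp_zero, exp_le_exp]
    positivity
  have hres : ∀ a b : (RatFunc k)[X], w a ≠ 0 → w a = w b →
      ∃ c : RatFunc k, w (a - C c * b) < w a := curveValuation_res hp'
  have hfrac : ∀ b : RatFunc k, ∃ r, w (C (b - φ r)) < 1 := by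
    intro b
    obtain ⟨r, hr⟩ := exists_degreeValuation_sub_lt b
    exact ⟨r, by rw [hwC]; exact pow_lt_one' hr hp'.ne'⟩
  have hcast : ∀ d : ℕ, d ≠ 0 → w (C (d : RatFunc k)) = 1 := by
    intro d hd
    have : (d : RatFunc k) = φ (d : k[X]) := by simp
    rw [hwC, this, degreeValuation_algebraMap (by exact_mod_cast hd)]
    simp
  have hint : HasIntegralMinimals w φ n := hasIntegralMinimals hres hone hφi hfrac hcast
    (P := P.map φ) ⟨P, rfl⟩ (hP.map φ) ((hP.natDegree_map φ).trans hPn)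
    (by rw [hw, curveValuation_map, hP0, map_zero, map_zero])
    (fun A hA0 hA => map_ne_zero_of_degree_lt hwne hTd' hT0 hA0 hA)
    (fun j hj => exists_isMinimal hwne hTd' hT0 hj) hp'
  obtain ⟨f, hfφ, hf, hf1⟩ := hint 1 hp
  obtain ⟨r, hr⟩ := coeff_mem_range hfφ 0
  have hfeq : f = (X + C r : k[X][X]).map φ := by
    rw [hf.1.eq_X_add_C hf1, ← hr]
    simp
  have hwf : w f = degreeValuation k (φ (q + r.comp p)) := by
    rw [hfeq, hw, curveValuation_map]
    simp [hφ]
  have hf0 : w f ≠ 0 := map_ne_zero_of_degree_lt hwne hTd' hT0 hf.1.ne_zero (by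
    rw [← natDegree_lt_iff_degree_lt hf.1.ne_zero, hf1]; exact hp)
  have hqr : q + r.comp p ≠ 0 := by
    intro h
    rw [hwf, h, map_zero, map_zero] at hf0
    exact hf0 rfl
  rw [degreeValuation_algebraMap hqr] at hwf
  refine ⟨-r, ?_⟩
  rw [neg_comp, sub_neg_eq_add]
  constructor
  · rw [Nat.pos_iff_ne_zero]
    intro h
    refine hf.ne_of_degree_lt hres hf0 (h := 1) ?_ ?_
    · rw [degree_eq_natDegree hf.1.ne_zero, hf1, degree_one]
      exact_mod_cast one_pos
    · rw [hwf, h, map_one]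
      simp
  · by_contra hcon
    rw [not_lt] at hcon
    obtain ⟨Q, hQn, hQ⟩ := exists_eval₂_eq_of_degree_lt hp' hs
      (X ^ ((q + r.comp p).natDegree - n))
    have hX : degreeValuation k (φ X)⁻¹ = exp (-1) := by
      rw [map_inv₀, degreeValuation_algebraMap X_ne_zero, natDegree_X, exp_neg]
      rfl
    refine map_C_mul_ne_of_mem_range hres hone hint hf hf0 (ρ := (φ X)⁻¹) ?_ ?_
      (Q := Q.map φ) ⟨Q, rfl⟩ (degree_map_le.trans_lt hQn) ?_
    · rw [hwC, hX]
      refine pow_lt_one' ?_ hp'.ne'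
      rw [← exp_zero, exp_lt_exp]
      norm_num
    · exact inv_ne_zero ((map_ne_zero_iff φ hφi).2 X_ne_zero)
    · rw [hw, curveValuation_map, hQ, degreeValuation_algebraMap (pow_ne_zero _ X_ne_zero),
        natDegree_X_pow, map_mul, ← hw, hwf, hwC, hX, ← exp_nsmul, ← exp_add, exp_inj]
      push_cast [Nat.cast_sub hcon]
      simp
      ring

end Plane

section Automorphism

variable {k : Type*} [Field k]

lemma exists_eval₂_eq_of_surjective {σ : MvPolynomial (Fin 2) k →ₐ[k] k[X]}
    (hσ : Function.Surjective σ) (f : k[X]) :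
    ∃ F : k[X][X], F.eval₂ (compRingHom (σ (MvPolynomial.X 0))) (σ (MvPolynomial.X 1)) = f := by
  obtain ⟨Φ, rfl⟩ := hσ f
  refine ⟨MvPolynomial.aeval ![C X, X] Φ, ?_⟩
  have h : (eval₂RingHom (compRingHom (σ (MvPolynomial.X 0))) (σ (MvPolynomial.X 1))).comp
      (MvPolynomial.aeval ![C X, X] : MvPolynomial (Fin 2) k →ₐ[k] k[X][X]).toRingHom =
        σ.toRingHom := by
    refine MvPolynomial.ringHom_ext (fun r => ?_) fun i => ?_
    · simp [← MvPolynomial.algebraMap_eq]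
    · fin_cases i <;> simp
  exact RingHom.congr_fun h Φ

/-- The automorphism fixing `X 0` and subtracting from `X 1` a polynomial in `X 0`. -/
noncomputable def shear (b : k[X]) : MvPolynomial (Fin 2) k ≃ₐ[k] MvPolynomial (Fin 2) k :=
  AlgEquiv.ofAlgHom
    (MvPolynomial.aeval ![MvPolynomial.X 0, MvPolynomial.X 1 - aeval (MvPolynomial.X 0) b])
    (MvPolynomial.aeval ![MvPolynomial.X 0, MvPolynomial.X 1 + aeval (MvPolynomial.X 0) b])
    (by
      refine MvPolynomial.algHom_ext fun i => ?_
      fin_cases i <;> simp [← aeval_algHom_apply])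
    (by
      refine MvPolynomial.algHom_ext fun i => ?_
      fin_cases i <;> simp [← aeval_algHom_apply])

lemma shear_X_zero (b : k[X]) : shear b (MvPolynomial.X 0) = MvPolynomial.X 0 := by
  simp [shear]

lemma shear_X_one (b : k[X]) :
    shear b (MvPolynomial.X 1) = MvPolynomial.X 1 - aeval (MvPolynomial.X 0) b := by
  simp [shear]

variable (k) in
/-- The automorphism exchanging the variables. -/
noncomputable def swapVars : MvPolynomial (Fin 2) k ≃ₐ[k] MvPolynomial (Fin 2) k :=
  MvPolynomial.renameEquiv k (Equiv.swap 0 1)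

lemma swapVars_X_zero : swapVars k (MvPolynomial.X 0) = MvPolynomial.X 1 := by
  simp [swapVars]

/-- The composite of `σ` with some automorphism sends `X 0` to `X` and `X 1` to `0`. -/
def IsRectifiable (σ : MvPolynomial (Fin 2) k →ₐ[k] k[X]) : Prop :=
  ∃ τ : MvPolynomial (Fin 2) k ≃ₐ[k] MvPolynomial (Fin 2) k,
    σ (τ (MvPolynomial.X 0)) = X ∧ σ (τ (MvPolynomial.X 1)) = 0

lemma IsRectifiable.of_comp {σ : MvPolynomial (Fin 2) k →ₐ[k] k[X]}
    {τ : MvPolynomial (Fin 2) k ≃ₐ[k] MvPolynomial (Fin 2) k}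
    (h : IsRectifiable (σ.comp τ.toAlgHom)) : IsRectifiable σ := by
  obtain ⟨ρ, h⟩ := h
  exact ⟨ρ.trans τ, h⟩

lemma isRectifiable_of_X_zero {σ : MvPolynomial (Fin 2) k →ₐ[k] k[X]}
    (h : σ (MvPolynomial.X 0) = X) : IsRectifiable σ := by
  refine ⟨shear (σ (MvPolynomial.X 1)), ?_, ?_⟩
  · rw [shear_X_zero, h]
  · rw [shear_X_one, map_sub, ← aeval_algHom_apply, h, aeval_X_left_apply, sub_self]

lemma isRectifiable_of_natDegree_eq_one {σ : MvPolynomial (Fin 2) k →ₐ[k] k[X]}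
    (h : (σ (MvPolynomial.X 0)).natDegree = 1) : IsRectifiable σ := by
  set p := σ (MvPolynomial.X 0) with hp
  set q := σ (MvPolynomial.X 1) with hq
  have ha : p.coeff 1 ≠ 0 := by
    rw [← h]
    exact leadingCoeff_ne_zero.2 (by rintro h0; simp [h0] at h)
  have hpe : p = C (p.coeff 1) * X + C (p.coeff 0) := eq_X_add_C_of_natDegree_le_one h.le
  set b : k[X] := (q - X).comp (C (p.coeff 1)⁻¹ * (X - C (p.coeff 0))) with hb
  have hbp : b.comp p = q - X := by
    have : (C (p.coeff 1)⁻¹ * (X - C (p.coeff 0))).comp p = X := by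
      rw [mul_comp, sub_comp, C_comp, C_comp, X_comp]
      nth_rewrite 2 [hpe]
      rw [add_sub_cancel_right, ← mul_assoc, ← C_mul, inv_mul_cancel₀ ha, C_1, one_mul]
    rw [hb, comp_assoc, this, comp_X]
  refine IsRectifiable.of_comp (τ := (swapVars k).trans (shear b)) (isRectifiable_of_X_zero ?_)
  change σ (shear b (swapVars k (MvPolynomial.X 0))) = X
  rw [swapVars_X_zero, shear_X_one, map_sub, ← aeval_algHom_apply, ← hp, ← hq,
    ← comp_eq_aeval, hbp, sub_sub_cancel]

lemma isRectifiable_of_natDegree_pos [CharZero k] {σ : MvPolynomial (Fin 2) k →ₐ[k] k[X]}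
    (hσ : Function.Surjective σ) (h : 0 < (σ (MvPolynomial.X 0)).natDegree) :
    IsRectifiable σ := by
  induction hn : (σ (MvPolynomial.X 0)).natDegree using Nat.strong_induction_on
    generalizing σ with
  | _ n ih =>
  rcases eq_or_lt_of_le (Nat.succ_le_of_lt h) with h1 | h1
  · exact isRectifiable_of_natDegree_eq_one h1.symm
  obtain ⟨b, hb0, hb⟩ := exists_natDegree_sub_comp_lt h1 (exists_eval₂_eq_of_surjective hσ)
  have he : σ.comp ((swapVars k).trans (shear b)).toAlgHom (MvPolynomial.X 0) =
      σ (MvPolynomial.X 1) - b.comp (σ (MvPolynomial.X 0)) := by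
    change σ (shear b (swapVars k (MvPolynomial.X 0))) = _
    rw [swapVars_X_zero, shear_X_one, map_sub, ← aeval_algHom_apply, ← comp_eq_aeval]
  refine IsRectifiable.of_comp (τ := (swapVars k).trans (shear b))
    (ih _ ?_ (hσ.comp (AlgEquiv.surjective _)) ?_ rfl)
  · rw [he, ← hn]; exact hb
  · rw [he]; exact hb0

/-- The embedding line theorem of Abhyankar–Moh and Suzuki. -/
theorem isRectifiable_of_surjective [CharZero k] {σ : MvPolynomial (Fin 2) k →ₐ[k] k[X]}
    (hσ : Function.Surjective σ) : IsRectifiable σ := by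
  rcases Nat.eq_zero_or_pos (σ (MvPolynomial.X 0)).natDegree with h0 | h0
  · refine IsRectifiable.of_comp (τ := swapVars k)
      (isRectifiable_of_natDegree_pos (hσ.comp (AlgEquiv.surjective _)) ?_)
    change 0 < (σ (swapVars k (MvPolynomial.X 0))).natDegree
    rw [swapVars_X_zero]
    by_contra h1
    have hC : σ = (Algebra.ofId k k[X]).comp
        (MvPolynomial.aeval fun i => (σ (MvPolynomial.X i)).coeff 0) := by
      refine MvPolynomial.algHom_ext fun i => ?_
      have hi : (σ (MvPolynomial.X i)).natDegree = 0 := by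
        fin_cases i
        · exact h0
        · exact Nat.eq_zero_of_not_pos h1
      rw [AlgHom.comp_apply, MvPolynomial.aeval_X]
      exact eq_C_of_natDegree_eq_zero hi
    obtain ⟨Φ, hΦ⟩ := hσ X
    rw [hC, AlgHom.comp_apply] at hΦ
    have := congrArg natDegree hΦ
    rw [natDegree_X, Algebra.ofId_apply, algebraMap_eq, natDegree_C] at this
    exact zero_ne_one this
  · exact isRectifiable_of_natDegree_pos hσ h0

end Automorphism

end LineEmbedding

end

/-- **The embedding line theorem (Abhyankar–Moh–Suzuki).**
If `σ : ℂ[X,Y] → ℂ[T]` is a surjective homomorphism of `ℂ`-algebras, then there is a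
`ℂ`-algebra automorphism `τ` of `ℂ[X,Y]` such that the composite `σ ∘ τ` sends `X` to `T`
and `Y` to `0`. -/
theorem stmt_19 (σ : MvPolynomial (Fin 2) ℂ →ₐ[ℂ] Polynomial ℂ)
    (hσ : Function.Surjective σ) :
    ∃ τ : MvPolynomial (Fin 2) ℂ ≃ₐ[ℂ] MvPolynomial (Fin 2) ℂ,
      σ (τ (MvPolynomial.X 0)) = Polynomial.X ∧ σ (τ (MvPolynomial.X 1)) = 0 := by
  exact LineEmbedding.isRectifiable_of_surjective hσ
end
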